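/- arXiv:2411.07761 — 2 statements merged into one kernel-verified Lean document; each statement's English description precedes it below -/
import Mathlib

section
/- Let f belong to the class S and let z ∈ 𝔻 with |z| = r < 1. Then r/(1+r)² ≤ |f(z)| ≤ r/(1−r)². -/
open Metric

section

open Complex MeasureTheory Set
open scoped Topology ENNReal ComplexConjugate

lemma lintegral_logArea_image {g g' : ℂ → ℂ} {s : Set ℂ} (hs : MeasurableSet s)
    (hg : ∀ z ∈ s, HasDerivAt g (g' z) z) (hinj : InjOn g s) :
    ∫⁻ w in g '' s, ENNReal.ofReal ((‖w‖ ^ 2)⁻¹) =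
      ∫⁻ z in s, ENNReal.ofReal (‖g' z / g z‖ ^ 2) := by
  rw [lintegral_image_eq_lintegral_abs_det_fderiv_mul volume hs
    (fun z hz ↦ ((hg z hz).hasFDerivAt.restrictScalars ℝ).hasFDerivWithinAt) hinj]
  refine lintegral_congr fun z ↦ ?_
  have hdet : ((ContinuousLinearMap.toSpanSingleton ℂ (g' z)).restrictScalars ℝ).det =
      ‖g' z‖ ^ 2 := by
    simp [ContinuousLinearMap.det, LinearMap.det_restrictScalars,
      Algebra.norm_complex_eq, Complex.normSq_eq_norm_sq]
  rw [hdet, ← ENNReal.ofReal_mul (abs_nonneg _), abs_of_nonneg (by positivity), norm_div, div_pow,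
    div_eq_mul_inv]

lemma injOn_exp_strip : InjOn exp {z : ℂ | z.im ∈ Ioc (-Real.pi) Real.pi} :=
  fun x hx y hy hxy ↦ by
    rw [← log_exp hx.1 hx.2, ← log_exp hy.1 hy.2, hxy]

lemma lintegral_reProdIm {s t : Set ℝ} (hs : MeasurableSet s) (ht : MeasurableSet t)
    {F : ℂ → ℝ≥0∞} (hF : AEMeasurable F (volume.restrict (s ×ℂ t))) :
    ∫⁻ z in s ×ℂ t, F z = ∫⁻ x in s, ∫⁻ y in t, F (x + y * I) := by
  have hmp := volume_preserving_equiv_real_prod.symm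
  have hpre : measurableEquivRealProd.symm ⁻¹' (s ×ℂ t) = s ×ˢ t := by
    ext p; simp [mem_reProdIm]
  have hmeas : MeasurableSet (s ×ℂ t) :=
    (measurable_re hs).inter (measurable_im ht)
  have hr := hmp.restrict_preimage hmeas
  rw [hpre] at hr
  rw [← hr.lintegral_comp_emb measurableEquivRealProd.symm.measurableEmbedding,
    Measure.volume_eq_prod, ← Measure.prod_restrict, lintegral_prod]
  · refine lintegral_congr fun x ↦ lintegral_congr fun y ↦ ?_
    congr 1
    apply Complex.ext <;> simp
  · rw [Measure.prod_restrict, ← Measure.volume_eq_prod]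
    exact hF.comp_quasiMeasurePreserving hr.quasiMeasurePreserving

lemma logArea_annulus_le {m : ℝ} (hm0 : 0 < m) (hm1 : m < 1) :
    ∫⁻ w in {w : ℂ | m ≤ ‖w‖ ∧ ‖w‖ ≤ m⁻¹}, ENNReal.ofReal ((‖w‖ ^ 2)⁻¹) ≤
      ENNReal.ofReal (4 * Real.pi * Real.log m⁻¹) := by
  set K : Set ℂ := Icc (Real.log m) (Real.log m⁻¹) ×ℂ Ioc (-Real.pi) Real.pi
  have hK : MeasurableSet K := (measurable_re measurableSet_Icc).inter
    (measurable_im measurableSet_Ioc)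
  have hsub : {w : ℂ | m ≤ ‖w‖ ∧ ‖w‖ ≤ m⁻¹} ⊆ exp '' K := by
    rintro w ⟨h1, h2⟩
    have hw : 0 < ‖w‖ := hm0.trans_le h1
    refine ⟨log w, ?_, exp_log (norm_pos_iff.1 hw)⟩
    simp only [K, mem_reProdIm, log_re, log_im, mem_Icc, mem_Ioc]
    exact ⟨⟨Real.log_le_log hm0 h1, Real.log_le_log hw h2⟩, neg_pi_lt_arg w, arg_le_pi w⟩
  calc _ ≤ ∫⁻ w in exp '' K, ENNReal.ofReal ((‖w‖ ^ 2)⁻¹) := lintegral_mono_set hsub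
    _ = ∫⁻ z in K, 1 := by
      rw [lintegral_logArea_image hK (fun z _ ↦ hasDerivAt_exp z)
        (injOn_exp_strip.mono fun z hz ↦ hz.2)]
      simp [exp_ne_zero]
    _ = _ := by
      rw [lintegral_reProdIm measurableSet_Icc measurableSet_Ioc aemeasurable_const]
      have : Real.log m ≤ 0 := Real.log_nonpos hm0.le hm1.le
      simp only [lintegral_const, Measure.restrict_apply MeasurableSet.univ, univ_inter,
        Real.volume_Icc, Real.volume_Ioc, one_mul, Real.log_inv]
      rw [← ENNReal.ofReal_mul (by linarith [Real.pi_pos])]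
      ring_nf

/-- The mean value property bounds the Dirichlet energy in logarithmic coordinates from below. -/
lemma le_lintegral_norm_sq_exp {h : ℂ → ℂ} (hd : DifferentiableOn ℂ h (ball 0 1)) (h0 : h 0 = 1)
    (ε : ℝ) :
    ENNReal.ofReal (2 * Real.pi * Real.log ε⁻¹) ≤
      ∫⁻ z in Ioo (Real.log ε) 0 ×ℂ Ioo (-Real.pi) Real.pi, ENNReal.ofReal (‖h (exp z)‖ ^ 2) := by
  have hexp : ∀ z : ℂ, z.re < 0 → exp z ∈ ball (0 : ℂ) 1 := fun z hz ↦ by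
    simpa [norm_exp] using hz
  have hcont : ContinuousOn (fun z ↦ ‖h (exp z)‖ ^ 2) {z : ℂ | z.re < 0} :=
    ((hd.continuousOn.comp continuous_exp.continuousOn hexp).norm).pow 2
  rw [lintegral_reProdIm measurableSet_Ioo measurableSet_Ioo]
  · have hin : ∀ x ∈ Ioo (Real.log ε) 0, ENNReal.ofReal (2 * Real.pi) ≤
        ∫⁻ y in Ioo (-Real.pi) Real.pi, ENNReal.ofReal (‖h (exp (x + y * I))‖ ^ 2) := by
      intro x hx
      have hc : Continuous fun y : ℝ ↦ h (exp (x + y * I)) :=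
        hd.continuousOn.comp_continuous (by fun_prop) fun y ↦ hexp _ (by simpa using hx.2)
      have hmean : ∫ y in (-Real.pi)..Real.pi, h (exp (x + y * I)) = 2 * Real.pi := by
        have hx1 : Real.exp x < 1 := by simpa using hx.2
        have := Real.circleAverage_eq_integral_add (f := h) (c := 0) (R := Real.exp x) (-Real.pi)
        rw [DiffContOnCl.circleAverage, h0] at this
        · rw [intervalIntegral.integral_comp_add_right (fun θ ↦ h (circleMap 0 (Real.exp x) θ))] at this
          have hpi : (2 * Real.pi : ℝ) ≠ 0 := by positivity
          rw [eq_inv_smul_iff₀ hpi] at this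
          have e : ∀ y : ℝ, exp (x + y * I) = circleMap 0 (Real.exp x) y := fun y ↦ by
            simp [circleMap, exp_add]
          simp_rw [e]
          rw [show (0 : ℝ) + -Real.pi = -Real.pi by ring,
            show 2 * Real.pi + -Real.pi = Real.pi by ring] at this
          rw [← this]
          simp
        · apply DifferentiableOn.diffContOnCl
          refine hd.mono (closure_ball_subset_closedBall.trans ?_)
          rw [abs_of_pos (Real.exp_pos x)]
          exact closedBall_subset_ball hx1
      have hre : ∫ y in (-Real.pi)..Real.pi, (h (exp (x + y * I))).re = 2 * Real.pi := by
        have := intervalIntegral.intervalIntegral_re (𝕜 := ℂ) (hc.intervalIntegrable (-Real.pi) Real.pi)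
          (μ := volume)
        simp only [RCLike.re_to_complex] at this
        rw [this, hmean]
        simp
      have hcre : Continuous fun y : ℝ ↦ 2 * (h (exp (x + y * I))).re :=
        continuous_const.mul (continuous_re.comp hc)
      have hle : 2 * Real.pi ≤ ∫ y in (-Real.pi)..Real.pi, ‖h (exp (x + y * I))‖ ^ 2 := by
        have h1 : ∫ y in (-Real.pi)..Real.pi, (2 * (h (exp (x + y * I))).re - 1) = 2 * Real.pi := by
          rw [intervalIntegral.integral_sub (hcre.intervalIntegrable _ _)
            (by simp), intervalIntegral.integral_const_mul, hre]
          simp; ring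
        rw [← h1]
        refine intervalIntegral.integral_mono_on (by linarith [Real.pi_pos])
          ((hcre.sub continuous_const).intervalIntegrable _ _)
          ((hc.norm.pow 2).intervalIntegrable _ _) fun y _ ↦ ?_
        rw [← normSq_eq_norm_sq, normSq_apply]
        nlinarith [sq_nonneg ((h (exp (x + y * I))).re - 1), sq_nonneg (h (exp (x + y * I))).im]
      rw [intervalIntegral.integral_of_le (by linarith [Real.pi_pos]),
        integral_Ioc_eq_integral_Ioo] at hle
      rw [← ofReal_integral_eq_lintegral_ofReal _ (ae_of_all _ fun y ↦ by positivity)]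
      · exact ENNReal.ofReal_le_ofReal hle
      · exact ((hc.norm.pow 2).integrableOn_Icc).mono_set Ioo_subset_Icc_self
    calc _ = ∫⁻ x in Ioo (Real.log ε) 0, ENNReal.ofReal (2 * Real.pi) := by
          simp [← ENNReal.ofReal_mul, Real.pi_pos.le]
      _ ≤ _ := setLIntegral_mono' measurableSet_Ioo hin
  · refine (ENNReal.measurable_ofReal.comp_aemeasurable
      ((hcont.mono fun z hz ↦ hz.1.2).aemeasurable ?_))
    exact (measurable_re measurableSet_Ioo).inter (measurable_im measurableSet_Ioo)

lemma exists_ball_subset_image_ball {q : ℂ → ℂ} (hq : DifferentiableOn ℂ q (ball 0 1))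
    (h0 : q 0 = 0) {a : ℝ} (ha0 : 0 < a) (ha : a < ‖deriv q 0‖) :
    ∃ ε ∈ Ioo (0 : ℝ) 1, a * ε < 1 ∧ ball 0 (a * ε) ⊆ q '' ball 0 ε := by
  have hana : AnalyticAt ℂ q 0 := hq.analyticAt (ball_mem_nhds 0 one_pos)
  have hne : deriv q 0 ≠ 0 := norm_pos_iff.1 (ha0.trans ha)
  have hs : HasStrictDerivAt q (deriv q 0) 0 := hana.hasStrictDerivAt
  set ψ := hs.localInverse q (deriv q 0) 0 hne
  have hψ : HasDerivAt ψ (deriv q 0)⁻¹ 0 := by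
    simpa [h0] using (hs.to_localInverse hne).hasDerivAt
  have hψ0 : ψ 0 = 0 := by
    simpa [h0] using (hs.eventually_left_inverse hne).self_of_nhds
  have hright : ∀ᶠ w in 𝓝 (0 : ℂ), q (ψ w) = w := by
    simpa [h0] using hs.eventually_right_inverse hne
  have hbound : ∀ᶠ w in 𝓝 (0 : ℂ), ‖ψ w‖ ≤ a⁻¹ * ‖w‖ := by
    have hgap : 0 < a⁻¹ - ‖deriv q 0‖⁻¹ := sub_pos.2 ((inv_lt_inv₀ (ha0.trans ha) ha0).2 ha)
    filter_upwards [hψ.isLittleO.def hgap] with w hw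
    simp only [hψ0, sub_zero, smul_eq_mul] at hw
    have := norm_le_norm_sub_add (ψ w) (w * (deriv q 0)⁻¹)
    rw [norm_mul, norm_inv] at this
    linarith
  obtain ⟨δ, hδ, hball⟩ := Metric.eventually_nhds_iff_ball.1 (hright.and hbound)
  refine ⟨min (1 / 2) (min (δ / a) (1 / (2 * a))), ⟨by positivity, ?_⟩, ?_, ?_⟩
  · exact (min_le_left _ _).trans_lt (by norm_num)
  · calc _ ≤ a * (1 / (2 * a)) := by gcongr; exact (min_le_right _ _).trans (min_le_right _ _)
      _ < 1 := by field_simp; norm_num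
  · intro w hw
    rw [mem_ball_zero_iff] at hw
    have hwδ : w ∈ ball (0 : ℂ) δ := by
      rw [mem_ball_zero_iff]
      refine hw.trans_le ?_
      calc _ ≤ a * (δ / a) := by gcongr; exact (min_le_right _ _).trans (min_le_left _ _)
        _ = δ := by field_simp
    obtain ⟨h1, h2⟩ := hball w hwδ
    refine ⟨ψ w, ?_, h1⟩
    rw [mem_ball_zero_iff]
    refine h2.trans_lt ?_
    rwa [inv_mul_lt_iff₀ ha0]

/-- A univalent function on the unit disc fixing the origin whose image is disjoint from its own
reciprocal has derivative of modulus at most `1` at the origin. -/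
lemma norm_deriv_le_one_of_mul_ne_one {q : ℂ → ℂ} (hq : DifferentiableOn ℂ q (ball 0 1))
    (hinj : InjOn q (ball 0 1)) (h0 : q 0 = 0)
    (hmul : ∀ z ∈ ball (0 : ℂ) 1, ∀ w ∈ ball (0 : ℂ) 1, q z * q w ≠ 1) :
    ‖deriv q 0‖ ≤ 1 := by
  by_contra! hgt
  obtain ⟨a, ha1, ha⟩ := exists_between hgt
  have ha0 : 0 < a := one_pos.trans ha1
  obtain ⟨ε, ⟨hε0, hε1⟩, hm1, himg⟩ := exists_ball_subset_image_ball hq h0 ha0 ha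
  set m := a * ε
  have hm0 : 0 < m := mul_pos ha0 hε0
  have h0mem : (0 : ℂ) ∈ ball (0 : ℂ) 1 := mem_ball_self one_pos
  have hqne : ∀ z ∈ ball (0 : ℂ) 1, z ≠ 0 → q z ≠ 0 := fun z hz hz0 hqz ↦
    hz0 (hinj hz h0mem (hqz.trans h0.symm))
  set R : Set ℂ := Ioo (Real.log ε) 0 ×ℂ Ioo (-Real.pi) Real.pi
  have hR : MeasurableSet R := (isOpen_Ioo.reProdIm isOpen_Ioo).measurableSet
  have hball : ∀ z ∈ R, exp z ∈ ball (0 : ℂ) 1 := fun z hz ↦ by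
    simpa [norm_exp] using hz.1.2
  have hlow : ∀ z ∈ R, ε < ‖exp z‖ := fun z hz ↦ by
    rw [norm_exp]
    exact (Real.log_lt_iff_lt_exp hε0).1 hz.1.1
  have hexpinj : InjOn exp R := injOn_exp_strip.mono fun z hz ↦
    show z.im ∈ Ioc (-Real.pi) Real.pi from ⟨hz.2.1, hz.2.2.le⟩
  have hPne : ∀ z ∈ R, q (exp z) ≠ 0 := fun z hz ↦ hqne _ (hball z hz) (exp_ne_zero z)
  have hPinj : InjOn (fun z ↦ q (exp z)) R := hinj.comp hexpinj hball
  have hPd : ∀ z ∈ R, HasDerivAt (fun z ↦ q (exp z)) (deriv q (exp z) * exp z) z := fun z hz ↦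
    (hq.differentiableAt (isOpen_ball.mem_nhds (hball z hz))).hasDerivAt.comp z (hasDerivAt_exp z)
  have hPlow : ∀ z ∈ R, m ≤ ‖q (exp z)‖ := fun z hz ↦ by
    by_contra! hlt
    obtain ⟨u, hu, hqu⟩ := himg (mem_ball_zero_iff.2 hlt)
    have := hinj (ball_subset_ball hε1.le hu) (hball z hz) hqu
    rw [this, mem_ball_zero_iff] at hu
    exact (hlow z hz).not_gt hu
  have hPup : ∀ z ∈ R, ‖q (exp z)‖ ≤ m⁻¹ := fun z hz ↦ by
    by_contra! hlt
    have : ‖(q (exp z))⁻¹‖ < m := by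
      rw [norm_inv]
      exact inv_lt_of_inv_lt₀ hm0 hlt
    obtain ⟨u, hu, hqu⟩ := himg (mem_ball_zero_iff.2 this)
    refine hmul _ (hball z hz) u (ball_subset_ball hε1.le hu) ?_
    rw [hqu, mul_inv_cancel₀ (hPne z hz)]
  -- the logarithmic derivative `z q'(z) / q(z)`, with its removable singularity filled in
  set h : ℂ → ℂ := fun z ↦ deriv q z / dslope q 0 z
  have hne : deriv q 0 ≠ 0 := norm_pos_iff.1 (one_pos.trans hgt)
  have hds : ∀ z ≠ 0, dslope q 0 z = q z / z := fun z hz ↦ by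
    rw [dslope_of_ne _ hz, slope_def_field, h0, sub_zero, sub_zero]
  have hhd : DifferentiableOn ℂ h (ball 0 1) := by
    refine (hq.deriv isOpen_ball).div
      ((differentiableOn_dslope (ball_mem_nhds 0 one_pos)).2 hq) fun z hz ↦ ?_
    rcases eq_or_ne z 0 with rfl | hz0
    · rwa [dslope_same]
    · rw [hds z hz0]
      exact div_ne_zero (hqne z hz hz0) hz0
  have hh0 : h 0 = 1 := by simp [h, hne]
  have hlower := le_lintegral_norm_sq_exp hhd hh0 ε
  have hA1 := lintegral_logArea_image hR hPd hPinj
  have hA2 := lintegral_logArea_image hR (fun z hz ↦ (hPd z hz).inv (hPne z hz))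
    (fun x hx y hy hxy ↦ hPinj hx hy (inv_injective hxy))
  have hE1 : ∫⁻ z in R, ENNReal.ofReal (‖deriv q (exp z) * exp z / q (exp z)‖ ^ 2) =
      ∫⁻ z in R, ENNReal.ofReal (‖h (exp z)‖ ^ 2) := by
    refine setLIntegral_congr_fun hR fun z hz ↦ ?_
    simp only [h, hds _ (exp_ne_zero z), div_div_eq_mul_div]
  have hE2 : ∫⁻ z in R, ENNReal.ofReal
      (‖-(deriv q (exp z) * exp z) / q (exp z) ^ 2 / (fun z ↦ q (exp z))⁻¹ z‖ ^ 2) =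
      ∫⁻ z in R, ENNReal.ofReal (‖h (exp z)‖ ^ 2) := by
    rw [← hE1]
    refine setLIntegral_congr_fun hR fun z hz ↦ ?_
    have := hPne z hz
    have e : -(deriv q (exp z) * exp z) / q (exp z) ^ 2 / (fun z ↦ q (exp z))⁻¹ z =
        -(deriv q (exp z) * exp z / q (exp z)) := by
      simp only [Pi.inv_apply]
      field_simp
    simp only [e, norm_neg]
  rw [hE1] at hA1
  rw [hE2] at hA2
  have hS2 : MeasurableSet ((fun z ↦ q (exp z))⁻¹ '' R) := by
    refine hR.image_of_continuousOn_injOn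
      (fun z hz ↦ ((hPd z hz).inv (hPne z hz)).continuousAt.continuousWithinAt)
      (fun x hx y hy hxy ↦ hPinj hx hy (inv_injective hxy))
  have hdisj : Disjoint ((fun z ↦ q (exp z)) '' R) ((fun z ↦ q (exp z))⁻¹ '' R) := by
    rw [Set.disjoint_left]
    rintro _ ⟨x, hx, rfl⟩ ⟨y, hy, hxy⟩
    refine hmul _ (hball x hx) _ (hball y hy) ?_
    rw [← show (q (exp y))⁻¹ = q (exp x) from hxy, inv_mul_cancel₀ (hPne y hy)]
  have hunion := lintegral_union (μ := volume)
    (f := fun w : ℂ ↦ ENNReal.ofReal ((‖w‖ ^ 2)⁻¹)) hS2 hdisj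
  rw [hA1, hA2] at hunion
  have hsub : (fun z ↦ q (exp z)) '' R ∪ (fun z ↦ q (exp z))⁻¹ '' R ⊆
      {w : ℂ | m ≤ ‖w‖ ∧ ‖w‖ ≤ m⁻¹} := by
    rintro _ (⟨z, hz, rfl⟩ | ⟨z, hz, rfl⟩)
    · exact ⟨hPlow z hz, hPup z hz⟩
    · simp only [Pi.inv_apply, mem_ofPred_eq, norm_inv]
      exact ⟨le_inv_of_le_inv₀ (hm0.trans_le (hPlow z hz)) (hPup z hz),
        inv_anti₀ hm0 (hPlow z hz)⟩
  have hfin := (add_le_add hlower hlower).trans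
    (hunion.symm.le.trans ((lintegral_mono_set hsub).trans (logArea_annulus_le hm0 hm1)))
  have hlogε : 0 < Real.log ε⁻¹ := Real.log_pos ((one_lt_inv₀ hε0).2 hε1)
  rw [← ENNReal.ofReal_add (by positivity) (by positivity),
    ENNReal.ofReal_le_ofReal_iff (mul_nonneg (by positivity)
      (Real.log_nonneg ((one_le_inv₀ hm0).2 hm1.le)))] at hfin
  have hlog : Real.log m⁻¹ = Real.log ε⁻¹ - Real.log a := by
    rw [Real.log_inv, Real.log_inv, Real.log_mul ha0.ne' hε0.ne']
    ring
  rw [hlog] at hfin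
  nlinarith [mul_pos Real.pi_pos (Real.log_pos ha1)]

lemma exists_differentiableOn_sq_eq {g : ℂ → ℂ} (hg : DifferentiableOn ℂ g (ball 0 1))
    (hne : ∀ z ∈ ball (0 : ℂ) 1, g z ≠ 0) (h0 : g 0 = 1) :
    ∃ s : ℂ → ℂ, DifferentiableOn ℂ s (ball 0 1) ∧ s 0 = 1 ∧
      ∀ z ∈ ball (0 : ℂ) 1, s z ^ 2 = g z := by
  obtain ⟨L, hL0, hL⟩ := (((hg.deriv isOpen_ball).div hg hne).isExactOn_ball).with_val_at 0 0
  have h0mem : (0 : ℂ) ∈ ball (0 : ℂ) 1 := mem_ball_self one_pos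
  have hd : ∀ z ∈ ball (0 : ℂ) 1, HasDerivAt (fun z ↦ g z * exp (-L z)) 0 z := fun z hz ↦ by
    refine ((hg.differentiableAt (isOpen_ball.mem_nhds hz)).hasDerivAt.mul
      ((hL z hz).fun_neg.cexp)).congr_deriv ?_
    have := hne z hz
    simp only [Pi.div_apply]
    field_simp
    ring
  have hconst : ∀ z ∈ ball (0 : ℂ) 1, g z * exp (-L z) = 1 := fun z hz ↦ by
    have := isOpen_ball.is_const_of_deriv_eq_zero (convex_ball (0 : ℂ) 1).isPreconnected
      (fun z hz ↦ (hd z hz).differentiableAt.differentiableWithinAt)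
      (fun z hz ↦ (hd z hz).deriv) hz h0mem
    simpa [hL0, h0] using this
  refine ⟨fun z ↦ exp (L z / 2), fun z hz ↦ ?_, by simp [hL0], fun z hz ↦ ?_⟩
  · exact ((hL z hz).div_const 2).cexp.differentiableAt.differentiableWithinAt
  · have := hconst z hz
    rw [exp_neg, ← div_eq_mul_inv, div_eq_one_iff_eq (exp_ne_zero _)] at this
    rw [this, ← exp_nat_mul]
    congr 1
    push_cast
    ring

lemma cayley_injective {a b : ℂ} (ha : 1 + a ≠ 0) (hb : 1 + b ≠ 0)
    (h : (1 - a) / (1 + a) = (1 - b) / (1 + b)) : a = b := by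
  rw [div_eq_div_iff ha hb] at h
  linear_combination (-1 / 2) * h

lemma hasDerivAt_cayley {a : ℂ} (ha : 1 + a ≠ 0) :
    HasDerivAt (fun a : ℂ ↦ (1 - a) / (1 + a)) (-2 / (1 + a) ^ 2) a := by
  refine (((hasDerivAt_id' a).const_sub 1).fun_div
    ((hasDerivAt_id' a).const_add 1) ha).congr_deriv ?_
  ring

/-- The Koebe one-quarter theorem. -/
lemma norm_deriv_le_four_mul_norm_of_omitted {F : ℂ → ℂ} (hF : DifferentiableOn ℂ F (ball 0 1))
    (hinj : InjOn F (ball 0 1)) (h0 : F 0 = 0) {w : ℂ} (hw : ∀ z ∈ ball (0 : ℂ) 1, F z ≠ w) :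
    ‖deriv F 0‖ ≤ 4 * ‖w‖ := by
  have h0mem : (0 : ℂ) ∈ ball (0 : ℂ) 1 := mem_ball_self one_pos
  have hw0 : w ≠ 0 := fun h ↦ hw 0 h0mem (h0.trans h.symm)
  obtain ⟨s, hs, hs0, hsq⟩ := exists_differentiableOn_sq_eq (g := fun z ↦ 1 - F z / w)
    ((hF.div_const w).const_sub 1)
    (fun z hz h ↦ hw z hz (by rw [sub_eq_zero, eq_comm, div_eq_one_iff_eq hw0] at h; exact h))
    (by simp [h0])
  have hsinj : ∀ x ∈ ball (0 : ℂ) 1, ∀ y ∈ ball (0 : ℂ) 1, s x ^ 2 = s y ^ 2 → x = y := by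
    intro x hx y hy hxy
    rw [hsq x hx, hsq y hy, sub_right_inj, div_left_inj' hw0] at hxy
    exact hinj hx hy hxy
  have hs1 : ∀ z ∈ ball (0 : ℂ) 1, 1 + s z ≠ 0 := fun z hz h ↦ by
    have hz1 : s z = -1 := by linear_combination h
    have := hsinj z hz 0 h0mem (by rw [hz1, hs0]; norm_num)
    rw [this, hs0] at hz1
    norm_num at hz1
  have hsd := (hs.differentiableAt (ball_mem_nhds 0 one_pos)).hasDerivAt
  have hderiv : deriv s 0 = -(deriv F 0 / w) / 2 := by
    have h1 := hsd.pow 2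
    have h2 : HasDerivAt (fun z ↦ 1 - F z / w) (-(deriv F 0 / w)) 0 :=
      ((hF.differentiableAt (ball_mem_nhds 0 one_pos)).hasDerivAt.div_const w).const_sub 1
    have h3 := h1.unique (h2.congr_of_eventuallyEq
      (Filter.eventuallyEq_of_mem (ball_mem_nhds 0 one_pos) hsq))
    simp only [hs0] at h3
    rw [← h3]
    norm_num
  have hq := norm_deriv_le_one_of_mul_ne_one (q := fun z ↦ (1 - s z) / (1 + s z))
    ((hs.const_sub 1).div (hs.const_add 1) hs1)
    (fun x hx y hy hxy ↦ hsinj x hx y hy (by rw [cayley_injective (hs1 x hx) (hs1 y hy) hxy]))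
    (by simp [hs0])
    (fun x hx y hy h ↦ by
      rw [div_mul_div_comm, div_eq_one_iff_eq (mul_ne_zero (hs1 x hx) (hs1 y hy))] at h
      have hxy : s x = -s y := by linear_combination (-1 / 2) * h
      have e := hsinj x hx y hy (by rw [hxy, neg_sq])
      rw [e] at hxy
      have hsy : s y = 0 := by linear_combination hxy / 2
      have := hsq y hy
      rw [hsy] at this
      refine hw y hy ?_
      field_simp at this
      linear_combination this)
  have hqd : deriv (fun z ↦ (1 - s z) / (1 + s z)) 0 = deriv F 0 / (4 * w) := by
    have hcomp : HasDerivAt (fun z ↦ (1 - s z) / (1 + s z)) (-2 / (1 + s 0) ^ 2 * deriv s 0) 0 :=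
      (hasDerivAt_cayley (hs1 0 h0mem)).comp 0 hsd
    rw [hcomp.deriv, hderiv, hs0]
    field_simp
    ring
  rw [hqd, norm_div, div_le_one (norm_pos_iff.2 (by simpa using hw0)), norm_mul] at hq
  simpa using hq

lemma one_add_ne_zero_of_re_pos {a : ℂ} (ha : 0 < a.re) : 1 + a ≠ 0 := fun h ↦ by
  have := congrArg re h
  simp only [add_re, one_re, zero_re] at this
  linarith

lemma norm_cayley_lt_one {a : ℂ} (ha : 0 < a.re) : ‖(1 - a) / (1 + a)‖ < 1 := by
  have h1 := one_add_ne_zero_of_re_pos ha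
  rw [norm_div, div_lt_one (norm_pos_iff.2 h1), ← sq_lt_sq₀ (norm_nonneg _) (norm_nonneg _),
    ← normSq_eq_norm_sq, ← normSq_eq_norm_sq, normSq_apply, normSq_apply]
  simp only [sub_re, add_re, sub_im, add_im, one_re, one_im]
  nlinarith

lemma one_add_ne_zero_of_mem_ball {z : ℂ} (hz : z ∈ ball (0 : ℂ) 1) : 1 + z ≠ 0 := fun h ↦ by
  have : z = -1 := by linear_combination h
  simp [this] at hz

lemma re_cayley_pos {z : ℂ} (hz : z ∈ ball (0 : ℂ) 1) : 0 < ((1 - z) / (1 + z)).re := by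
  have h1 : 0 < normSq (1 + z) := normSq_pos.2 (one_add_ne_zero_of_mem_ball hz)
  have h2 : normSq z < 1 := by
    rw [normSq_eq_norm_sq]
    exact pow_lt_one₀ (norm_nonneg _) (mem_ball_zero_iff.1 hz) two_ne_zero
  rw [normSq_apply] at h2
  rw [div_re, ← add_div]
  refine div_pos ?_ h1
  simp only [sub_re, add_re, sub_im, add_im, one_re, one_im]
  nlinarith

/-- The Pick function: a conformal map of the unit disc into the disc slit along `[r, 1)`. -/
lemma exists_univalent_slit_disc {r : ℝ} (hr0 : 0 < r) :
    ∃ p : ℂ → ℂ, DifferentiableOn ℂ p (ball 0 1) ∧ MapsTo p (ball 0 1) (ball 0 1) ∧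
      InjOn p (ball 0 1) ∧ p 0 = 0 ∧ deriv p 0 = (4 * r / (1 + r) ^ 2 : ℝ) ∧
      ∀ z ∈ ball (0 : ℂ) 1, p z ≠ r := by
  set c : ℝ := 4 * r / (1 + r) ^ 2 with hc
  have hc0 : 0 < c := by positivity
  have h1c : 1 - c = ((1 - r) / (1 + r)) ^ 2 := by
    rw [hc]
    field_simp
    ring
  have h1c0 : 0 ≤ 1 - c := h1c ▸ sq_nonneg _
  set H : ℂ → ℂ := fun z ↦ (1 - z) / (1 + z)
  have hH : ∀ z ∈ ball (0 : ℂ) 1, 0 < (H z).re := fun z hz ↦ re_cayley_pos hz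
  have hHd : ∀ z ∈ ball (0 : ℂ) 1, HasDerivAt H (-2 / (1 + z) ^ 2) z := fun z hz ↦
    hasDerivAt_cayley (one_add_ne_zero_of_mem_ball hz)
  set X : ℂ → ℂ := fun z ↦ (1 - c : ℝ) + c * H z ^ 2
  have hX : ∀ z ∈ ball (0 : ℂ) 1, X z ∈ slitPlane := fun z hz ↦ by
    have := hH z hz
    rw [mem_slitPlane_iff]
    by_cases him : (H z).im = 0
    · left
      simp only [X, add_re, ofReal_re, ofReal_im, sq, mul_re, him]
      nlinarith [mul_pos hc0 (mul_pos this this)]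
    · right
      simp only [X, add_im, ofReal_im, ofReal_re, sq, mul_im, zero_add]
      have := mul_ne_zero hc0.ne' (mul_ne_zero this.ne' him)
      contrapose! this
      linarith
  have hXd : ∀ z ∈ ball (0 : ℂ) 1,
      HasDerivAt X (c * (2 * H z * (-2 / (1 + z) ^ 2))) z := fun z hz ↦ by
    refine ((((hHd z hz).fun_pow 2).const_mul (c : ℂ)).const_add
      ((1 - c : ℝ) : ℂ)).congr_deriv ?_
    norm_num
  set T : ℂ → ℂ := fun z ↦ exp (log (X z) / 2)
  have hT : ∀ z ∈ ball (0 : ℂ) 1, 0 < (T z).re := fun z hz ↦ by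
    have hz := hX z hz
    have h1 := neg_pi_lt_arg (X z)
    have h2 := (mem_slitPlane_iff_arg.1 hz).1
    have h3 := (arg_le_pi (X z)).lt_of_ne h2
    rw [exp_re]
    refine mul_pos (Real.exp_pos _) (Real.cos_pos_of_mem_Ioo ?_)
    have : (log (X z) / 2).im = arg (X z) / 2 := by simp [log_im]
    rw [this]
    constructor <;> linarith
  have hTsq : ∀ z ∈ ball (0 : ℂ) 1, T z ^ 2 = X z := fun z hz ↦ by
    simp only [T]
    rw [← exp_nat_mul, Nat.cast_two, mul_div_cancel₀ _ two_ne_zero,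
      exp_log (slitPlane_ne_zero (hX z hz))]
  have hTd : ∀ z ∈ ball (0 : ℂ) 1,
      HasDerivAt T (T z * (c * (2 * H z * (-2 / (1 + z) ^ 2)) / X z / 2)) z := fun z hz ↦
    (((hXd z hz).clog (hX z hz)).div_const 2).cexp
  have hT1 : ∀ z ∈ ball (0 : ℂ) 1, 1 + T z ≠ 0 := fun z hz ↦ one_add_ne_zero_of_re_pos (hT z hz)
  have hpd : ∀ z ∈ ball (0 : ℂ) 1, HasDerivAt (fun z ↦ (1 - T z) / (1 + T z))
      (-2 / (1 + T z) ^ 2 * (T z * (c * (2 * H z * (-2 / (1 + z) ^ 2)) / X z / 2))) z :=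
    fun z hz ↦ (hasDerivAt_cayley (hT1 z hz)).comp z (hTd z hz)
  have h0mem : (0 : ℂ) ∈ ball (0 : ℂ) 1 := mem_ball_self one_pos
  have hH0 : H 0 = 1 := by simp [H]
  have hX0 : X 0 = 1 := by simp [X, hH0]
  have hT0 : T 0 = 1 := by simp [T, hX0]
  refine ⟨fun z ↦ (1 - T z) / (1 + T z), fun z hz ↦ (hpd z hz).differentiableAt.differentiableWithinAt,
    fun z hz ↦ mem_ball_zero_iff.2 (norm_cayley_lt_one (hT z hz)), fun x hx y hy hxy ↦ ?_,
    by simp [hT0], ?_, fun z hz h ↦ ?_⟩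
  · have e := cayley_injective (hT1 x hx) (hT1 y hy) hxy
    have e2 : X x = X y := by rw [← hTsq x hx, ← hTsq y hy, e]
    have e3 : H x ^ 2 = H y ^ 2 :=
      mul_left_cancel₀ (ofReal_ne_zero.2 hc0.ne') (add_left_cancel e2)
    rcases sq_eq_sq_iff_eq_or_eq_neg.1 e3 with e4 | e4
    · exact cayley_injective (one_add_ne_zero_of_mem_ball hx) (one_add_ne_zero_of_mem_ball hy) e4
    · have h1 := hH x hx
      rw [e4, neg_re] at h1
      linarith [hH y hy]
  · rw [(hpd 0 h0mem).deriv, hT0, hX0, hH0]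
    norm_num
    ring
  · have hr1 : (1 + r : ℂ) ≠ 0 := by exact_mod_cast (by positivity : (1 + r : ℝ) ≠ 0)
    have hTz : T z = (1 - r) / (1 + r) := by
      rw [div_eq_iff (hT1 z hz)] at h
      rw [eq_div_iff hr1]
      linear_combination -h
    have e := hTsq z hz
    have hcast : ((1 - c : ℝ) : ℂ) = ((1 - r) / (1 + r)) ^ 2 := by
      rw [h1c]
      push_cast
      rfl
    simp only [X] at e
    rw [hTz, hcast, left_eq_add] at e
    have hHz : H z = 0 := by simpa [hc0.ne'] using e
    have := hH z hz
    rw [hHz] at this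
    exact lt_irrefl _ this

lemma norm_deriv_mul_le_norm_sub {F : ℂ → ℂ} (hF : DifferentiableOn ℂ F (ball 0 1))
    (hinj : InjOn F (ball 0 1)) {z : ℂ} (hz : z ∈ ball (0 : ℂ) 1) :
    ‖deriv F 0‖ * (‖z‖ / (1 + ‖z‖) ^ 2) ≤ ‖F z - F 0‖ := by
  rcases eq_or_ne z 0 with rfl | hz0
  · simp
  have hr0 : 0 < ‖z‖ := norm_pos_iff.2 hz0
  obtain ⟨p, hp, hmaps, hpinj, hp0, hpd, hpr⟩ := exists_univalent_slit_disc hr0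
  set u : ℂ := z / ‖z‖
  have hzn : (‖z‖ : ℂ) ≠ 0 := by exact_mod_cast hr0.ne'
  have hu : ‖u‖ = 1 := by simp [u, hz0]
  have hu0 : u ≠ 0 := norm_pos_iff.1 (by rw [hu]; exact one_pos)
  have huz : u * ‖z‖ = z := div_mul_cancel₀ _ hzn
  have hm : MapsTo (fun x ↦ u * p x) (ball 0 1) (ball 0 1) := fun x hx ↦ by
    have := hmaps hx
    rw [mem_ball_zero_iff] at this ⊢
    rwa [norm_mul, hu, one_mul]
  have hd : HasDerivAt (fun x ↦ F (u * p x) - F 0)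
      (deriv F 0 * (u * (4 * ‖z‖ / (1 + ‖z‖) ^ 2 : ℝ))) 0 := by
    have hpd' := (hp.differentiableAt (ball_mem_nhds 0 one_pos)).hasDerivAt.const_mul u
    rw [hpd] at hpd'
    have hFd : HasDerivAt F (deriv F 0) (u * p 0) := by
      rw [hp0, mul_zero]
      exact (hF.differentiableAt (ball_mem_nhds 0 one_pos)).hasDerivAt
    exact (hFd.comp 0 hpd').sub_const _
  have := norm_deriv_le_four_mul_norm_of_omitted (F := fun x ↦ F (u * p x) - F 0) (w := F z - F 0)
    ((hF.comp (hp.const_mul u) hm).sub_const _)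
    (fun x hx y hy hxy ↦ hpinj hx hy (mul_left_cancel₀ hu0
      (hinj (hm hx) (hm hy) (sub_left_injective hxy))))
    (by simp [hp0])
    (fun x hx h ↦ hpr x hx (mul_left_cancel₀ hu0
      ((hinj (hm hx) hz (sub_left_injective h)).trans huz.symm)))
  rw [hd.deriv, norm_mul, norm_mul, hu, one_mul, norm_real, Real.norm_of_nonneg (by positivity)]
    at this
  have e : ‖deriv F 0‖ * (4 * ‖z‖ / (1 + ‖z‖) ^ 2) =
    4 * (‖deriv F 0‖ * (‖z‖ / (1 + ‖z‖) ^ 2)) := by ring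
  linarith

lemma norm_deriv_mul_le_norm {f : ℂ → ℂ} (hf : DifferentiableOn ℂ f (ball 0 1))
    (hinj : InjOn f (ball 0 1)) (hf0 : f 0 = 0) {a : ℂ} (ha : a ∈ ball (0 : ℂ) 1) :
    ‖deriv f a‖ * (‖a‖ * (1 - ‖a‖)) ≤ (1 + ‖a‖) * ‖f a‖ := by
  have ha1 : ‖a‖ < 1 := mem_ball_zero_iff.1 ha
  have hden : ∀ z ∈ ball (0 : ℂ) 1, 1 + conj a * z ≠ 0 := fun z hz ↦ by
    refine one_add_ne_zero_of_mem_ball ?_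
    rw [mem_ball_zero_iff] at hz ⊢
    rw [norm_mul, RCLike.norm_conj]
    nlinarith [norm_nonneg z, norm_nonneg a]
  set M : ℂ → ℂ := fun z ↦ (z + a) / (1 + conj a * z)
  have hM : MapsTo M (ball 0 1) (ball 0 1) := fun z hz ↦ by
    have hz1 : ‖z‖ < 1 := mem_ball_zero_iff.1 hz
    rw [mem_ball_zero_iff, norm_div, div_lt_one (norm_pos_iff.2 (hden z hz)),
      ← sq_lt_sq₀ (norm_nonneg _) (norm_nonneg _), ← normSq_eq_norm_sq, ← normSq_eq_norm_sq,
      normSq_apply, normSq_apply]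
    have h1 : normSq z < 1 := by
      rw [normSq_eq_norm_sq]
      exact pow_lt_one₀ (norm_nonneg _) hz1 two_ne_zero
    have h2 : normSq a < 1 := by
      rw [normSq_eq_norm_sq]
      exact pow_lt_one₀ (norm_nonneg _) ha1 two_ne_zero
    rw [normSq_apply] at h1 h2
    simp only [add_re, add_im, one_re, one_im, mul_re, mul_im, conj_re, conj_im]
    nlinarith [mul_pos (sub_pos.2 h1) (sub_pos.2 h2)]
  have hMd : ∀ z ∈ ball (0 : ℂ) 1,
      HasDerivAt M ((1 - ‖a‖ ^ 2 : ℝ) / (1 + conj a * z) ^ 2) z := fun z hz ↦ by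
    refine (((hasDerivAt_id' z).add_const a).fun_div
      (((hasDerivAt_id' z).const_mul (conj a)).const_add 1) (hden z hz)).congr_deriv ?_
    rw [← normSq_eq_norm_sq, ofReal_sub, normSq_eq_conj_mul_self]
    push_cast
    ring
  have hna : (1 : ℂ) - conj a * a ≠ 0 := by
    have := hden (-a) (by simpa using ha)
    rwa [mul_neg, ← sub_eq_add_neg] at this
  have hMinj : InjOn M (ball 0 1) := fun x hx y hy hxy ↦ by
    simp only [M] at hxy
    rw [div_eq_div_iff (hden x hx) (hden y hy)] at hxy
    exact mul_right_cancel₀ hna (by linear_combination hxy)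
  have hM0 : M 0 = a := by simp [M]
  have hMa : M (-a) = 0 := by simp [M]
  have hfa := (hf.differentiableAt (isOpen_ball.mem_nhds ha)).hasDerivAt
  have h0 := hMd 0 (mem_ball_self one_pos)
  have hd : HasDerivAt (f ∘ M) (deriv f a * (1 - ‖a‖ ^ 2 : ℝ)) 0 := by
    rw [← hM0] at hfa
    simpa [hM0] using hfa.comp 0 h0
  have := norm_deriv_mul_le_norm_sub
    (hf.comp (fun z hz ↦ (hMd z hz).differentiableAt.differentiableWithinAt) hM)
    (hinj.comp hMinj hM) (z := -a) (by simpa using ha)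
  have hpos : 0 < 1 - ‖a‖ ^ 2 := by nlinarith [norm_nonneg a]
  rw [hd.deriv, norm_mul, norm_real, Real.norm_of_nonneg hpos.le, Function.comp_apply,
    Function.comp_apply, hM0, hMa, hf0, zero_sub, norm_neg, norm_neg] at this
  have hp : 0 < 1 + ‖a‖ := by positivity
  calc _ = (1 + ‖a‖) * (‖deriv f a‖ * (1 - ‖a‖ ^ 2) * (‖a‖ / (1 + ‖a‖) ^ 2)) := by
        field_simp
        ring
    _ ≤ _ := by gcongr

lemma norm_le_div_one_sub_sq {f : ℂ → ℂ} (hf : DifferentiableOn ℂ f (ball 0 1))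
    (hinj : InjOn f (ball 0 1)) (hf0 : f 0 = 0) {z : ℂ} (hz : z ∈ ball (0 : ℂ) 1) :
    ‖f z‖ ≤ ‖deriv f 0‖ * (‖z‖ / (1 - ‖z‖) ^ 2) := by
  rcases eq_or_ne z 0 with rfl | hz0
  · simp [hf0]
  have hr0 : 0 < ‖z‖ := norm_pos_iff.2 hz0
  have hr1 : ‖z‖ < 1 := mem_ball_zero_iff.1 hz
  set u : ℂ := z / ‖z‖
  have hzn : (‖z‖ : ℂ) ≠ 0 := by exact_mod_cast hr0.ne'
  have hu : ‖u‖ = 1 := by simp [u, hz0]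
  have huz : ‖z‖ * u = z := mul_div_cancel₀ _ hzn
  have hnorm : ∀ t : ℝ, 0 ≤ t → ‖t * u‖ = t := fun t ht ↦ by
    rw [norm_mul, hu, mul_one, norm_real, Real.norm_of_nonneg ht]
  have hmem : ∀ t : ℝ, 0 ≤ t → t < 1 → t * u ∈ ball (0 : ℂ) 1 := fun t ht ht1 ↦ by
    rwa [mem_ball_zero_iff, hnorm t ht]
  have hg : ∀ t : ℝ, 0 ≤ t → t < 1 →
      HasDerivAt (fun t : ℝ ↦ f (t * u)) (deriv f (t * u) * u) t := fun t ht ht1 ↦ by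
    have h1 : HasDerivAt (fun s : ℂ ↦ s * u) u (t : ℂ) := by
      simpa using (hasDerivAt_id' (t : ℂ)).mul_const u
    exact ((hf.differentiableAt (isOpen_ball.mem_nhds (hmem t ht ht1))).hasDerivAt.comp
      (t : ℂ) h1).comp_ofReal
  set v : ℝ → ℝ := fun t ↦ ‖f (t * u)‖ ^ 2 * ((1 - t) ^ 4 / t ^ 2)
  set v' : ℝ → ℝ := fun t ↦ 2 * inner ℝ (f (t * u)) (deriv f (t * u) * u) * ((1 - t) ^ 4 / t ^ 2) +
    ‖f (t * u)‖ ^ 2 * (-(2 * (1 + t) * (1 - t) ^ 3) / t ^ 3)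
  have hv : ∀ t ∈ Ioo (0 : ℝ) 1, HasDerivAt v (v' t) t := fun t ht ↦ by
    have hk : HasDerivAt (fun t : ℝ ↦ (1 - t) ^ 4 / t ^ 2)
        (-(2 * (1 + t) * (1 - t) ^ 3) / t ^ 3) t := by
      refine ((((hasDerivAt_id' t).const_sub 1).fun_pow 4).fun_div ((hasDerivAt_id' t).fun_pow 2)
        (pow_ne_zero 2 ht.1.ne')).congr_deriv ?_
      have := ht.1.ne'
      field_simp
      ring
    exact ((hg t ht.1.le ht.2).norm_sq).mul hk
  have hv' : ∀ t ∈ Ioo (0 : ℝ) 1, v' t ≤ 0 := fun t ht ↦ by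
    have h1t : 0 < 1 - t := sub_pos.2 ht.2
    have ht0 := ht.1
    have hin : inner ℝ (f (t * u)) (deriv f (t * u) * u) ≤ ‖f (t * u)‖ * ‖deriv f (t * u)‖ :=
      (real_inner_le_norm _ _).trans_eq (by rw [norm_mul, hu, mul_one])
    have hb := norm_deriv_mul_le_norm hf hinj hf0 (hmem t ht.1.le ht.2)
    rw [hnorm t ht.1.le] at hb
    have key : inner ℝ (f (t * u)) (deriv f (t * u) * u) * (t * (1 - t)) ≤
        (1 + t) * ‖f (t * u)‖ ^ 2 := by
      calc _ ≤ ‖f (t * u)‖ * ‖deriv f (t * u)‖ * (t * (1 - t)) := by gcongr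
        _ = ‖f (t * u)‖ * (‖deriv f (t * u)‖ * (t * (1 - t))) := by ring
        _ ≤ ‖f (t * u)‖ * ((1 + t) * ‖f (t * u)‖) := by gcongr
        _ = _ := by ring
    have e : v' t = -(2 * (1 - t) ^ 3 / t ^ 3 * ((1 + t) * ‖f (t * u)‖ ^ 2 -
        inner ℝ (f (t * u)) (deriv f (t * u) * u) * (t * (1 - t)))) := by
      simp only [v']
      field_simp
      ring
    rw [e, neg_nonpos]
    exact mul_nonneg (by positivity) (sub_nonneg.2 key)
  have hanti : AntitoneOn v (Ioo 0 1) := by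
    refine antitoneOn_of_deriv_nonpos (convex_Ioo 0 1)
      (fun t ht ↦ (hv t ht).continuousAt.continuousWithinAt) ?_ ?_
    · rw [interior_Ioo]
      exact fun t ht ↦ (hv t ht).differentiableAt.differentiableWithinAt
    · rw [interior_Ioo]
      exact fun t ht ↦ (hv t ht).deriv.trans_le (hv' t ht)
  have hlim : Filter.Tendsto v (𝓝[>] 0) (𝓝 (‖deriv f 0‖ ^ 2)) := by
    have h1 := hasDerivAt_iff_tendsto_slope.1 (hg 0 le_rfl one_pos)
    have h2 : Filter.Tendsto (fun t : ℝ ↦ (1 - t) ^ 4) (𝓝[>] 0) (𝓝 1) := by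
      have : Continuous fun t : ℝ ↦ (1 - t) ^ 4 := by fun_prop
      simpa using (this.tendsto 0).mono_left nhdsWithin_le_nhds
    have h3 := ((h1.mono_left (nhdsWithin_mono 0 fun t (ht : 0 < t) ↦ ht.ne')).norm.pow 2).mul h2
    simp only [ofReal_zero, zero_mul, norm_mul, hu, mul_one] at h3
    refine h3.congr' (Filter.eventually_of_mem self_mem_nhdsWithin fun t ht ↦ ?_)
    simp only [slope, v, vsub_eq_sub, ofReal_zero, zero_mul, hf0, sub_zero, norm_smul, norm_inv,
      Real.norm_eq_abs, mul_pow, inv_pow, sq_abs]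
    ring
  have hle : v ‖z‖ ≤ ‖deriv f 0‖ ^ 2 := by
    refine ge_of_tendsto hlim (Filter.eventually_of_mem (Ioo_mem_nhdsGT hr0) fun t ht ↦ ?_)
    exact hanti ⟨ht.1, ht.2.trans hr1⟩ ⟨hr0, hr1⟩ ht.2.le
  have h1r : 0 < 1 - ‖z‖ := sub_pos.2 hr1
  have hve : v ‖z‖ = (‖f z‖ * ((1 - ‖z‖) ^ 2 / ‖z‖)) ^ 2 := by
    simp only [v, huz]
    ring
  rw [hve, sq_le_sq₀ (by positivity) (norm_nonneg _)] at hle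
  calc ‖f z‖ = ‖f z‖ * ((1 - ‖z‖) ^ 2 / ‖z‖) * (‖z‖ / (1 - ‖z‖) ^ 2) := by field_simp
    _ ≤ _ := by gcongr

end

/-- **The Growth Theorem.** For `f` in the class `S` and `|z| = r < 1`,
`r/(1+r)² ≤ |f(z)| ≤ r/(1-r)²`. -/
theorem growth_theorem (f : ℂ → ℂ)
    (hf : DifferentiableOn ℂ f (ball (0 : ℂ) 1))
    (hinj : Set.InjOn f (ball (0 : ℂ) 1))
    (hf0 : f 0 = 0) (hf1 : deriv f 0 = 1)
    (z : ℂ) (r : ℝ) (hz : ‖z‖ = r) (hr : r < 1) :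
    r / (1 + r) ^ 2 ≤ ‖f z‖ ∧ ‖f z‖ ≤ r / (1 - r) ^ 2 := by
  have hz1 : z ∈ ball (0 : ℂ) 1 := mem_ball_zero_iff.2 (hz.trans_lt hr)
  have hlower := norm_deriv_mul_le_norm_sub hf hinj hz1
  have hupper := norm_le_div_one_sub_sq hf hinj hf0 hz1
  rw [hf1, norm_one, one_mul, hz] at hlower hupper
  rw [hf0, sub_zero] at hlower
  exact ⟨hlower, hupper⟩
end

section
/- Let f belong to the class S, with Taylor coefficients a_n = f⁽ⁿ⁾(0)/n!. Then for every n ≥ 2, |a_n| ≤ e·n, where e = exp(1). -/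
open Metric

open MeasureTheory Filter Topology

theorem exists_eq_sum_add_pow_mul {F : ℂ → ℂ} (hF : DifferentiableOn ℂ F (ball 0 1)) (N : ℕ) :
    ∃ (c : ℕ → ℂ) (R : ℂ → ℂ), DifferentiableOn ℂ R (ball 0 1) ∧
      ∀ z, F z = ∑ j ∈ Finset.range N, c j * z ^ j + z ^ N * R z := by
  induction N generalizing F with
  | zero => exact ⟨0, F, hF, by simp⟩
  | succ N ih =>
    have hd : DifferentiableOn ℂ (dslope F 0) (ball 0 1) :=
      (Complex.differentiableOn_dslope (ball_mem_nhds 0 one_pos)).2 hF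
    obtain ⟨c, R, hR, h⟩ := ih hd
    refine ⟨fun j => if j = 0 then F 0 else c (j - 1), R, hR, fun z => ?_⟩
    have hz := sub_smul_dslope F 0 z
    rw [h z, smul_eq_mul, sub_zero, mul_add, Finset.mul_sum] at hz
    rw [Finset.sum_range_succ', ← eq_sub_iff_add_eq.1 hz]
    simp only [pow_succ, Nat.add_eq_zero_iff, one_ne_zero, and_false, if_false, if_true,
      Nat.add_sub_cancel]
    have : ∀ j, z * (c j * z ^ j) = c j * (z ^ j * z) := fun j => by ring
    simp only [this]
    ring

theorem iteratedDeriv_zero_of_eq_sum_add_pow_mul {F R : ℂ → ℂ} {c : ℕ → ℂ} {m k : ℕ} (hk : k < m)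
    (hR : DifferentiableOn ℂ R (ball 0 1))
    (h : ∀ z ∈ ball (0 : ℂ) 1, F z = ∑ j ∈ Finset.range m, c j * z ^ j + z ^ m * R z) :
    iteratedDeriv k F 0 = k.factorial * c k := by
  have hRa : ContDiffAt ℂ k R 0 :=
    (hR.analyticAt (ball_mem_nhds 0 one_pos)).contDiffAt
  have hev : F =ᶠ[𝓝 0] fun z => ∑ j ∈ Finset.range m, c j * z ^ j + z ^ m * R z := by
    filter_upwards [ball_mem_nhds (0 : ℂ) one_pos] with z hz using h z hz
  rw [hev.iteratedDeriv_eq, iteratedDeriv_fun_add (by fun_prop) (by fun_prop),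
    iteratedDeriv_fun_mul (by fun_prop) hRa, iteratedDeriv_fun_sum (fun _ _ => by fun_prop)]
  rw [Finset.sum_eq_single k, Finset.sum_eq_zero, add_zero, iteratedDeriv_const_mul_field,
    iteratedDeriv_fun_pow_zero]
  · simp [mul_comm]
  · intro i hi
    rw [iteratedDeriv_fun_pow_zero, if_neg (by have := Finset.mem_range.1 hi; omega)]
    simp
  · intro j _ hj
    rw [iteratedDeriv_const_mul_field, iteratedDeriv_fun_pow_zero, if_neg (Ne.symm hj)]
    simp
  · intro hn
    exact absurd (Finset.mem_range.2 hk) hn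

theorem sphere_subset_ball_of_lt {t : ℝ} (ht : 0 < t) (ht1 : t < 1) :
    sphere (0 : ℂ) |t| ⊆ ball 0 1 := fun z hz => by
  rw [abs_of_pos ht] at hz
  exact mem_ball.2 (by rw [mem_sphere.1 hz]; exact ht1)

/-- Bessel's inequality on circles for a holomorphic function with lacunary Taylor expansion. -/
theorem sum_le_circleAverage_norm_sq {d : ℕ} (hd : d ≠ 0) {t : ℝ} (ht : 0 < t) (ht1 : t < 1)
    {F R : ℂ → ℂ} {N : ℕ} {c : ℕ → ℂ} (hR : DifferentiableOn ℂ R (ball 0 1))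
    (h : ∀ z ∈ ball (0 : ℂ) 1,
      F z = ∑ j ∈ Finset.range N, c j * z ^ (d * j) + z ^ (d * N) * R z) :
    ∑ j ∈ Finset.range N, ‖c j‖ ^ 2 * t ^ (2 * d * j) ≤
      Real.circleAverage (fun z => ‖F z‖ ^ 2) 0 t := by
  induction N generalizing F c with
  | zero =>
    simp only [Finset.range_zero, Finset.sum_empty]
    exact Real.circleAverage_nonneg_of_nonneg fun _ _ => by positivity
  | succ N ih =>
    set F₁ : ℂ → ℂ := fun z =>
      ∑ j ∈ Finset.range N, c (j + 1) * z ^ (d * j) + z ^ (d * N) * R z with hF₁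
    have hF₁d : DifferentiableOn ℂ F₁ (ball 0 1) := by
      rw [hF₁]; fun_prop
    have hF : ∀ z ∈ ball (0 : ℂ) 1, F z = c 0 + z ^ d * F₁ z := fun z hz => by
      rw [h z hz, Finset.sum_range_succ', hF₁]
      simp only [mul_add, Finset.mul_sum, pow_add, mul_one, mul_zero, pow_zero]
      have : ∀ j, z ^ d * (c (j + 1) * z ^ (d * j)) = c (j + 1) * (z ^ (d * j) * z ^ d) :=
        fun j => by ring
      simp only [this]
      ring
    have ih' := ih (F := F₁) (c := fun j => c (j + 1)) (fun z _ => rfl)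
    have hs := sphere_subset_ball_of_lt ht ht1
    have hcb : closedBall (0 : ℂ) |t| ⊆ ball 0 1 := by
      rw [abs_of_pos ht]; exact closedBall_subset_ball ht1
    set G : ℂ → ℂ := fun z => 2 * (starRingEnd ℂ (c 0)) * (z ^ d * F₁ z) with hG
    have hGd : DifferentiableOn ℂ G (ball 0 1) := by rw [hG]; fun_prop
    have hGc : ContinuousOn G (sphere 0 |t|) := hGd.continuousOn.mono hs
    have hFc : ContinuousOn F₁ (sphere 0 |t|) := hF₁d.continuousOn.mono hs
    have hmean : Real.circleAverage G 0 t = 0 := by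
      rw [DiffContOnCl.circleAverage]
      · simp [hG, hd]
      · exact (hGd.mono hcb).diffContOnCl_ball subset_rfl
    have hmeanre : Real.circleAverage (fun z => (G z).re) 0 t = 0 := by
      have := Complex.reCLM.circleAverage_comp_comm (f := G) (c := 0) (R := t)
        hGc.circleIntegrable'
      rw [hmean] at this
      simpa [Function.comp_def] using this
    have hcongr : Real.circleAverage (fun z => ‖F z‖ ^ 2) 0 t =
        Real.circleAverage (fun z => (‖c 0‖ ^ 2 + (G z).re) + t ^ (2 * d) * ‖F₁ z‖ ^ 2) 0 t := by
      refine Real.circleAverage_congr_sphere fun z hz => ?_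
      have hzt : ‖z‖ = t := by rw [abs_of_pos ht] at hz; simpa using hz
      rw [hF z (hs hz), ← hzt, pow_mul', ← norm_pow z d, ← mul_pow, ← norm_mul]
      simp only [← Complex.normSq_eq_norm_sq, Complex.normSq_add, hG]
      generalize z ^ d * F₁ z = w
      simp
      ring
    rw [hcongr, Real.circleAverage_fun_add, Real.circleAverage_fun_add, hmeanre,
      Real.circleAverage_const]
    · have : Real.circleAverage (fun z => t ^ (2 * d) * ‖F₁ z‖ ^ 2) 0 t =
          t ^ (2 * d) * Real.circleAverage (fun z => ‖F₁ z‖ ^ 2) 0 t := by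
        simpa [smul_eq_mul] using Real.circleAverage_fun_smul (a := t ^ (2 * d))
          (f := fun z => ‖F₁ z‖ ^ 2) (c := (0 : ℂ)) (R := t)
      rw [this, Finset.sum_range_succ']
      have h2 := mul_le_mul_of_nonneg_left ih' (pow_nonneg ht.le (2 * d))
      rw [Finset.mul_sum] at h2
      have h3 : ∀ j, ‖c (j + 1)‖ ^ 2 * t ^ (2 * d * (j + 1)) =
        t ^ (2 * d) * (‖c (j + 1)‖ ^ 2 * t ^ (2 * d * j)) := fun j => by ring
      simp only [h3]
      simp only [mul_zero, pow_zero, mul_one]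
      linarith
    · exact (continuousOn_const).circleIntegrable'
    · exact (Complex.continuous_re.comp_continuousOn hGc).circleIntegrable'
    · exact (continuousOn_const.add
        (Complex.continuous_re.comp_continuousOn hGc)).circleIntegrable'
    · exact ((hFc.norm.pow 2).const_mul _).circleIntegrable'

theorem volume_image_eq_lintegral {g g' : ℂ → ℂ} {A : Set ℂ} (hA : MeasurableSet A)
    (hg : ∀ z ∈ A, HasDerivAt g (g' z) z) (hinj : Set.InjOn g A) :
    volume (g '' A) = ∫⁻ z in A, ENNReal.ofReal (‖g' z‖ ^ 2) := by
  have h := lintegral_image_eq_lintegral_abs_det_fderiv_mul volume hA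
    (fun z hz => ((hg z hz).hasFDerivAt.restrictScalars ℝ).hasFDerivWithinAt) hinj 1
  simp only [Pi.one_apply, mul_one, lintegral_const, MeasurableSet.univ, Measure.restrict_apply,
    Set.univ_inter, one_mul] at h
  rw [h]
  refine lintegral_congr fun z => ?_
  congr 1
  have : ((ContinuousLinearMap.restrictScalars ℝ
      (ContinuousLinearMap.toSpanSingleton ℂ (g' z)))).det = ‖g' z‖ ^ 2 := by
    rw [ContinuousLinearMap.det, ← Complex.normSq_eq_norm_sq, ← Algebra.norm_complex_apply]
    refine (LinearMap.det_restrictScalars (R := ℝ) (S := ℂ)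
      (f := (ContinuousLinearMap.toSpanSingleton ℂ (g' z)).toLinearMap)).trans ?_
    simp
  rw [this, abs_of_nonneg (by positivity)]

/-- Polar coordinates lower bound for an integral over an annulus. -/
theorem ofReal_sub_le_lintegral_annulus {Φ : ℂ → ℝ} {ε s : ℝ} (hε : 0 ≤ ε) (hεs : ε ≤ s)
    {G L : ℝ → ℝ} (hΦ : ContinuousOn Φ {z | ε < ‖z‖ ∧ ‖z‖ < s}) (hΦ0 : ∀ z, 0 ≤ Φ z)
    (hG : ∀ t ∈ Set.Icc ε s, HasDerivAt G (2 * Real.pi * (t * L t)) t)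
    (hLc : ContinuousOn L (Set.Icc ε s)) (hL0 : ∀ t ∈ Set.Ioo ε s, 0 ≤ L t)
    (hL : ∀ t ∈ Set.Ioo ε s, L t ≤ Real.circleAverage Φ 0 t) :
    ENNReal.ofReal (G s - G ε) ≤ ∫⁻ z in {z | ε < ‖z‖ ∧ ‖z‖ < s}, ENNReal.ofReal (Φ z) := by
  set A : Set ℂ := {z | ε < ‖z‖ ∧ ‖z‖ < s} with hA
  have hAo : IsOpen A := (isOpen_lt continuous_const continuous_norm).inter
    (isOpen_lt continuous_norm continuous_const)
  have hAm : MeasurableSet A := hAo.measurableSet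
  set T : Set (ℝ × ℝ) := Set.Ioo ε s ×ˢ Set.Ioo (-Real.pi) Real.pi with hT
  have hTm : MeasurableSet T := measurableSet_Ioo.prod measurableSet_Ioo
  have hTsub : T ⊆ polarCoord.target := fun p hp =>
    ⟨lt_of_le_of_lt hε hp.1.1, hp.2⟩
  have hpc : ∀ p : ℝ × ℝ, Complex.polarCoord.symm p = circleMap 0 p.1 p.2 := fun p => by
    simp [circleMap, Complex.exp_mul_I]
  have hmem : ∀ p ∈ T, circleMap 0 p.1 p.2 ∈ A := fun p hp => by
    simp only [hA, Set.mem_ofPred_eq, norm_circleMap_zero, abs_of_pos (lt_of_le_of_lt hε hp.1.1)]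
    exact hp.1
  have hcc : Continuous fun p : ℝ × ℝ => circleMap 0 p.1 p.2 := by
    unfold circleMap; fun_prop
  have hcont : ContinuousOn (fun p : ℝ × ℝ => p.1 * Φ (circleMap 0 p.1 p.2)) T :=
    continuousOn_fst.mul (hΦ.comp hcc.continuousOn hmem)
  calc ENNReal.ofReal (G s - G ε)
      = ENNReal.ofReal (∫ t in Set.Ioo ε s, 2 * Real.pi * (t * L t)) := by
        have hci : ContinuousOn (fun t => 2 * Real.pi * (t * L t)) (Set.uIcc ε s) := by
          rw [Set.uIcc_of_le hεs]; fun_prop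
        rw [← integral_Ioc_eq_integral_Ioo, ← intervalIntegral.integral_of_le hεs,
          intervalIntegral.integral_eq_sub_of_hasDerivAt
            (by rw [Set.uIcc_of_le hεs]; exact hG) hci.intervalIntegrable]
    _ = ∫⁻ t in Set.Ioo ε s, ENNReal.ofReal (2 * Real.pi * (t * L t)) := by
        rw [ofReal_integral_eq_lintegral_ofReal]
        · have : ContinuousOn (fun t => 2 * Real.pi * (t * L t)) (Set.Icc ε s) := by fun_prop
          exact (this.integrableOn_Icc).mono_set Set.Ioo_subset_Icc_self
        · refine (ae_restrict_iff' measurableSet_Ioo).2 (ae_of_all _ fun t ht => ?_)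
          have := hL0 t ht
          have h2 : 0 < t := lt_of_le_of_lt hε ht.1
          simp only [Pi.zero_apply]
          positivity
    _ ≤ ∫⁻ t in Set.Ioo ε s, ∫⁻ θ in Set.Ioo (-Real.pi) Real.pi,
          ENNReal.ofReal (t * Φ (circleMap 0 t θ)) := by
        refine setLIntegral_mono' measurableSet_Ioo fun t ht => ?_
        have ht0 : 0 < t := lt_of_le_of_lt hε ht.1
        have hcθ : Continuous fun θ => t * Φ (circleMap 0 t θ) := by
          refine continuous_const.mul (hΦ.comp_continuous (continuous_circleMap 0 t) fun θ => ?_)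
          simp only [hA, Set.mem_ofPred_eq, norm_circleMap_zero, abs_of_pos ht0]
          exact ht
        rw [← ofReal_integral_eq_lintegral_ofReal]
        · refine ENNReal.ofReal_le_ofReal ?_
          have h1 := hL t ht
          rw [Real.circleAverage_eq_integral_add (-Real.pi), smul_eq_mul] at h1
          rw [← integral_Ioc_eq_integral_Ioo, ← intervalIntegral.integral_of_le
            (by linarith [Real.pi_pos]), intervalIntegral.integral_const_mul]
          have h3 : ∫ θ in (0 : ℝ)..2 * Real.pi, Φ (circleMap 0 t (θ + -Real.pi)) =
              ∫ θ in (-Real.pi)..Real.pi, Φ (circleMap 0 t θ) := by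
            rw [intervalIntegral.integral_comp_add_right (fun θ => Φ (circleMap 0 t θ))]
            congr 1 <;> ring
          rw [h3] at h1
          have h4 : 2 * Real.pi * L t ≤ ∫ θ in (-Real.pi)..Real.pi, Φ (circleMap 0 t θ) := by
            have := mul_le_mul_of_nonneg_left h1 Real.two_pi_pos.le
            rwa [mul_inv_cancel_left₀ Real.two_pi_pos.ne'] at this
          nlinarith
        · exact (hcθ.integrableOn_Icc).mono_set Set.Ioo_subset_Icc_self
        · exact ae_of_all _ fun θ => mul_nonneg ht0.le (hΦ0 _)
    _ = ∫⁻ p in T, ENNReal.ofReal (p.1 * Φ (circleMap 0 p.1 p.2)) := by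
        rw [hT, Measure.volume_eq_prod, setLIntegral_prod]
        exact ((hcont.aemeasurable hTm).ennreal_ofReal)
    _ ≤ ∫⁻ p in polarCoord.target, ENNReal.ofReal p.1 •
          A.indicator (fun z => ENNReal.ofReal (Φ z)) (Complex.polarCoord.symm p) := by
        refine le_trans (setLIntegral_mono' hTm fun p hp => ?_) (lintegral_mono_set hTsub)
        rw [hpc, Set.indicator_of_mem (hmem p hp), smul_eq_mul, ← ENNReal.ofReal_mul]
        exact (lt_of_le_of_lt hε hp.1.1).le
    _ = ∫⁻ z in A, ENNReal.ofReal (Φ z) := by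
        rw [Complex.lintegral_comp_polarCoord_symm, lintegral_indicator hAm]

theorem norm_sub_mul_conj_le {z b m : ℂ} {ε M : ℝ} (hε : 0 < ε) (hεz : ε < ‖z‖) (hz : ‖z‖ < 1)
    (hm : ‖m‖ ≤ M) (hεM : ε * (2 * ‖b‖ + 3 * (M * (1 + ‖b‖))) ≤ 1) :
    ‖(z⁻¹ + b * z + z ^ 3 * m) -
        (ε ^ 2 * b) * (starRingEnd ℂ) (z⁻¹ + b * z + z ^ 3 * m)‖ ≤
      ε⁻¹ + ‖b‖ ^ 2 * ε ^ 2 + M * (1 + ‖b‖) * ε ^ 3 := by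
  set t := ‖z‖ with ht
  set B := ‖b‖ with hB
  have ht0 : 0 < t := hε.trans hεz
  have hB0 : 0 ≤ B := norm_nonneg b
  have hM0 : 0 ≤ M := (norm_nonneg m).trans hm
  have hz0 : z ≠ 0 := norm_pos_iff.1 ht0
  set u := (starRingEnd ℂ) z with hu
  have hut : ‖u‖ = t := by rw [hu, RCLike.norm_conj]
  have hu0 : u ≠ 0 := norm_pos_iff.1 (hut ▸ ht0)
  have hzu : z * u = (t : ℂ) ^ 2 := by rw [hu, Complex.mul_conj']
  have hzinv : u⁻¹ = z * ((t : ℂ) ^ 2)⁻¹ := by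
    rw [← hzu]; field_simp
  have key : (z⁻¹ + b * z + z ^ 3 * m) -
        (ε ^ 2 * b) * (starRingEnd ℂ) (z⁻¹ + b * z + z ^ 3 * m) =
      z⁻¹ + b * (z * ((1 - ε ^ 2 * (t ^ 2)⁻¹ : ℝ) : ℂ))
        + (-((ε : ℂ) ^ 2 * b * (starRingEnd ℂ) b * u)) + z ^ 3 * m
        + (-((ε : ℂ) ^ 2 * b * u ^ 3 * (starRingEnd ℂ) m)) := by
    simp only [map_add, map_mul, map_inv₀, map_pow, ← hu]
    rw [hzinv]
    push_cast
    ring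
  have h1 : 0 ≤ 1 - ε ^ 2 * (t ^ 2)⁻¹ := by
    rw [sub_nonneg, ← div_eq_mul_inv, div_le_one (by positivity)]
    gcongr
  rw [key]
  refine (norm_add_le _ _).trans ((add_le_add_left ((norm_add_le _ _).trans
    (add_le_add_left ((norm_add_le _ _).trans (add_le_add_left (norm_add_le _ _) _)) _)) _).trans ?_)
  simp only [norm_neg, norm_mul, norm_pow, norm_inv, RCLike.norm_conj, hut, ← ht, ← hB,
    Complex.norm_real, Real.norm_eq_abs, abs_of_pos hε, abs_of_nonneg h1]
  have e1 : B * (t * (1 - ε ^ 2 * (t ^ 2)⁻¹)) ≤ 2 * B * (t - ε) := by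
    have : t * (1 - ε ^ 2 * (t ^ 2)⁻¹) = (t - ε) * ((t + ε) / t) := by
      field_simp; ring
    have h2 : (t + ε) / t ≤ 2 := by rw [div_le_iff₀ ht0]; linarith
    have h3 : (t - ε) * ((t + ε) / t) ≤ (t - ε) * 2 :=
      mul_le_mul_of_nonneg_left h2 (by linarith)
    rw [this]; nlinarith
  have e2 : ε ^ 2 * B * B * t ≤ B ^ 2 * ε ^ 2 := by
    nlinarith [mul_nonneg (sq_nonneg (ε * B)) (sub_nonneg.2 hz.le)]
  have e3 : t ^ 3 ≤ ε ^ 3 + 3 * (t - ε) := by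
    have : t ^ 3 - ε ^ 3 = (t - ε) * (t ^ 2 + t * ε + ε ^ 2) := by ring
    have h4 : t ^ 2 + t * ε + ε ^ 2 ≤ 3 := by nlinarith
    nlinarith [mul_le_mul_of_nonneg_left h4 (sub_nonneg.2 hεz.le)]
  have e4 : t ^ 3 * ‖m‖ + ε ^ 2 * B * t ^ 3 * ‖m‖ ≤ M * (1 + B) * t ^ 3 := by
    have h5 : ε ^ 2 ≤ 1 := by nlinarith
    have h6 : ε ^ 2 * B ≤ B := mul_le_of_le_one_left hB0 h5
    have h7 : (1 + ε ^ 2 * B) * ‖m‖ ≤ (1 + B) * M := by gcongr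
    nlinarith [mul_le_mul_of_nonneg_left h7 (pow_nonneg ht0.le 3)]
  have e5 : t⁻¹ + (t - ε) * (2 * B + 3 * (M * (1 + B))) ≤ ε⁻¹ := by
    have h8 : 2 * B + 3 * (M * (1 + B)) ≤ ε⁻¹ * t⁻¹ := by
      have : 2 * B + 3 * (M * (1 + B)) ≤ ε⁻¹ := by
        rw [← one_div, le_div_iff₀ hε]; linarith
      exact this.trans (le_mul_of_one_le_right (by positivity) ((one_le_inv₀ ht0).2 hz.le))
    have h9 : (t - ε) * (ε⁻¹ * t⁻¹) = ε⁻¹ - t⁻¹ := by field_simp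
    nlinarith [mul_le_mul_of_nonneg_left h8 (sub_nonneg.2 hεz.le)]
  have e6 := mul_le_mul_of_nonneg_left e3 (mul_nonneg hM0 (add_nonneg zero_le_one hB0))
  nlinarith

/-- The real-linear map `z ↦ z - c * conj z`. -/
noncomputable def subMulConj (c : ℂ) : ℂ →ₗ[ℝ] ℂ :=
  LinearMap.id - (LinearMap.mulLeft ℝ c).comp Complex.conjAe.toLinearMap

theorem subMulConj_apply (c z : ℂ) : subMulConj c z = z - c * (starRingEnd ℂ) z := rfl

theorem det_subMulConj (c : ℂ) : LinearMap.det (subMulConj c) = 1 - ‖c‖ ^ 2 := by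
  rw [← LinearMap.det_toMatrix Complex.basisOneI, Matrix.det_fin_two]
  simp only [LinearMap.toMatrix_apply, subMulConj_apply, ← Complex.normSq_eq_norm_sq,
    Complex.normSq_apply]
  simp
  ring

/-- Gronwall's area theorem, for the first coefficient of an odd function. -/
theorem norm_le_one_of_injOn_inv_add {b : ℂ} {m : ℂ → ℂ} (hm : DifferentiableOn ℂ m (ball 0 1))
    (hinj : Set.InjOn (fun z : ℂ => z⁻¹ + b * z + z ^ 3 * m (z ^ 2)) (ball 0 1 \ {0})) :
    ‖b‖ ≤ 1 := by
  set g : ℂ → ℂ := fun z => z⁻¹ + b * z + z ^ 3 * m (z ^ 2) with hg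
  set B := ‖b‖ with hB
  have hsq : Set.MapsTo (fun z : ℂ => z ^ 2) (ball 0 1) (ball 0 1) := fun z hz => by
    rw [mem_ball_zero_iff] at hz ⊢
    rw [norm_pow]
    exact pow_lt_one₀ (norm_nonneg z) hz two_ne_zero
  have hm' : DifferentiableOn ℂ (deriv m) (ball 0 1) := hm.deriv isOpen_ball
  set R : ℂ → ℂ := fun z => 3 * m (z ^ 2) + 2 * z ^ 2 * deriv m (z ^ 2) with hR
  have hRd : DifferentiableOn ℂ R (ball 0 1) := by
    have h1 := hm.fun_comp (differentiableOn_pow 2) hsq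
    have h2 := hm'.fun_comp (differentiableOn_pow 2) hsq
    rw [hR]; fun_prop
  set F : ℂ → ℂ := fun z => -1 + b * z ^ 2 + z ^ 4 * R z with hF
  have hFd : DifferentiableOn ℂ F (ball 0 1) := by rw [hF]; fun_prop
  have hgd : ∀ z ∈ ball (0 : ℂ) 1 \ {0}, HasDerivAt g (F z / z ^ 2) z := fun z hz => by
    have hz0 : z ≠ 0 := hz.2
    have h1 : HasDerivAt m (deriv m (z ^ 2)) (z ^ 2) :=
      (hm.differentiableAt (isOpen_ball.mem_nhds (hsq hz.1))).hasDerivAt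
    have h2 : HasDerivAt (fun z => m (z ^ 2)) (deriv m (z ^ 2) * (2 * z)) z := by
      exact (h1.comp z (hasDerivAt_pow 2 z)).congr_deriv (by simp)
    have h3 := ((hasDerivAt_inv hz0).add ((hasDerivAt_id z).const_mul b)).add
      ((hasDerivAt_pow 3 z).mul h2)
    refine h3.congr_deriv ?_
    simp only [hF, hR]
    field_simp
    push_cast
    ring
  have main : ∀ r : ℝ, 0 < r → r < 1 → B ^ 2 * r ^ 2 ≤ (r ^ 2)⁻¹ := by
    intro r hr hr1
    obtain ⟨M, hM⟩ := (isCompact_closedBall (0 : ℂ) r).exists_bound_of_continuousOn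
      (hm.continuousOn.mono (closedBall_subset_ball hr1))
    set K : ℝ := B ^ 2 + M * (1 + B) + 1 with hK
    have hM0 : 0 ≤ M := (norm_nonneg _).trans (hM 0 (by simp [hr.le]))
    have hB0 : 0 ≤ B := norm_nonneg b
    have hK0 : 0 < K := by positivity
    have hsmall : ∀ᶠ ε : ℝ in 𝓝[>] 0, (1 - ε ^ 4 * B ^ 2) * (B ^ 2 * r ^ 2 - (r ^ 2)⁻¹) -
        (2 * K * ε + K ^ 2 * ε ^ 4 + B ^ 2 * ε ^ 2 + (1 - ε ^ 4 * B ^ 2) * B ^ 2 * ε ^ 2) ≤ 0 := by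
      have c1 : ∀ᶠ ε : ℝ in 𝓝[>] 0, ε * (2 * B + 3 * (M * (1 + B))) < 1 :=
        nhdsWithin_le_nhds ((by fun_prop : Continuous fun ε : ℝ =>
          ε * (2 * B + 3 * (M * (1 + B)))).continuousAt.eventually_lt continuousAt_const (by simp))
      have c2 : ∀ᶠ ε : ℝ in 𝓝[>] 0, ε ^ 4 * B ^ 2 < 1 :=
        nhdsWithin_le_nhds ((by fun_prop : Continuous fun ε : ℝ =>
          ε ^ 4 * B ^ 2).continuousAt.eventually_lt continuousAt_const (by simp))
      have c3 : ∀ᶠ ε : ℝ in 𝓝[>] 0, ε < r := nhdsWithin_le_nhds (gt_mem_nhds hr)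
      filter_upwards [c1, c2, c3, self_mem_nhdsWithin] with ε h1 h2 h3 hε
      replace hε : 0 < ε := hε
      set A : Set ℂ := {z | ε < ‖z‖ ∧ ‖z‖ < r} with hA
      have hAsub : A ⊆ ball 0 1 \ {0} := fun z hz =>
        ⟨mem_ball_zero_iff.2 (hz.2.trans hr1), norm_pos_iff.1 (hε.trans hz.1)⟩
      have hAm : MeasurableSet A := ((isOpen_lt continuous_const continuous_norm).inter
        (isOpen_lt continuous_norm continuous_const)).measurableSet
      have harea := volume_image_eq_lintegral hAm (fun z hz => hgd z (hAsub hz)) (hinj.mono hAsub)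
      have hlow : ENNReal.ofReal (Real.pi * (B ^ 2 * r ^ 2 - (r ^ 2)⁻¹) -
          Real.pi * (B ^ 2 * ε ^ 2 - (ε ^ 2)⁻¹)) ≤ volume (g '' A) := by
        rw [harea]
        refine ofReal_sub_le_lintegral_annulus (Φ := fun z => ‖F z / z ^ 2‖ ^ 2)
          (G := fun t => Real.pi * (B ^ 2 * t ^ 2 - (t ^ 2)⁻¹))
          (L := fun t => (t ^ 4)⁻¹ + B ^ 2) hε.le h3.le ?_ (fun z => by positivity) ?_ ?_
          (fun t _ => by positivity) ?_
        · refine ((ContinuousOn.div (hFd.continuousOn.mono (hAsub.trans Set.sdiff_subset))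
            (by fun_prop) fun z hz => ?_).norm).pow 2
          exact pow_ne_zero 2 (hAsub hz).2
        · intro t ht
          have ht0 : t ≠ 0 := (hε.trans_le ht.1).ne'
          have := (((hasDerivAt_pow 2 t).const_mul (B ^ 2)).sub
            ((hasDerivAt_pow 2 t).inv (pow_ne_zero 2 ht0))).const_mul Real.pi
          refine this.congr_deriv ?_
          field_simp
          push_cast
          ring
        · refine ContinuousOn.add (ContinuousOn.inv₀ (by fun_prop) fun t ht => ?_)
            continuousOn_const
          exact pow_ne_zero 4 (hε.trans_le ht.1).ne'
        · intro t ht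
          have ht0 : 0 < t := hε.trans ht.1
          have hB := sum_le_circleAverage_norm_sq (d := 2) (N := 2)
            (c := fun j => if j = 0 then -1 else b) two_ne_zero ht0 (ht.2.trans hr1) hRd
            (F := F) (fun z _ => by simp [Finset.sum_range_succ, hF])
          have hc : Real.circleAverage (fun z => ‖F z / z ^ 2‖ ^ 2) 0 t =
              (t ^ 4)⁻¹ * Real.circleAverage (fun z => ‖F z‖ ^ 2) 0 t := by
            rw [← smul_eq_mul, ← Real.circleAverage_fun_smul]
            refine Real.circleAverage_congr_sphere fun z hz => ?_
            have hzt : ‖z‖ = t := by rw [abs_of_pos ht0] at hz; simpa using hz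
            rw [norm_div, norm_pow, hzt, smul_eq_mul, div_pow, ← pow_mul]
            exact div_eq_inv_mul _ _
          simp only [Finset.sum_range_succ, Finset.range_zero, Finset.sum_empty] at hB
          norm_num at hB
          rw [hc]
          calc (t ^ 4)⁻¹ + ‖b‖ ^ 2 = (t ^ 4)⁻¹ * (1 + ‖b‖ ^ 2 * t ^ 4) := by field_simp
            _ ≤ _ := mul_le_mul_of_nonneg_left hB (by positivity)
      have hc2 : ‖(ε : ℂ) ^ 2 * b‖ ^ 2 = ε ^ 4 * B ^ 2 := by
        rw [norm_mul, norm_pow, Complex.norm_real, Real.norm_eq_abs, abs_of_pos hε]; ring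
      have hdet : LinearMap.det (subMulConj (ε ^ 2 * b)) = 1 - ε ^ 4 * B ^ 2 := by
        rw [det_subMulConj, hc2]
      have hdpos : 0 < 1 - ε ^ 4 * B ^ 2 := by linarith
      have hsub : g '' A ⊆ subMulConj (ε ^ 2 * b) ⁻¹' ball 0 (ε⁻¹ + K * ε ^ 2) := by
        rintro _ ⟨z, hz, rfl⟩
        rw [Set.mem_preimage, mem_ball_zero_iff, subMulConj_apply]
        have hz1 : ‖z‖ < 1 := hz.2.trans hr1
        have hzr : z ^ 2 ∈ closedBall (0 : ℂ) r := by
          rw [mem_closedBall_zero_iff, norm_pow]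
          nlinarith [hz.2, norm_nonneg z]
        refine (norm_sub_mul_conj_le hε hz.1 hz1 (hM _ hzr) h1.le).trans_lt ?_
        have hε1 : ε < 1 := h3.trans hr1
        have : M * (1 + B) * ε ^ 3 ≤ M * (1 + B) * ε ^ 2 :=
          mul_le_mul_of_nonneg_left (pow_le_pow_of_le_one hε.le hε1.le (by norm_num))
            (by positivity)
        have : 0 < ε ^ 2 := by positivity
        rw [hK]
        nlinarith
      have hup : volume (g '' A) ≤ ENNReal.ofReal
          ((1 - ε ^ 4 * B ^ 2)⁻¹ * ((ε⁻¹ + K * ε ^ 2) ^ 2 * Real.pi)) := by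
        refine (measure_mono hsub).trans ?_
        rw [Measure.addHaar_preimage_linearMap _ (by rw [hdet]; exact hdpos.ne'), hdet,
          Complex.volume_ball, abs_of_pos (inv_pos.2 hdpos),
          ENNReal.ofReal_mul (inv_pos.2 hdpos).le, ENNReal.ofReal_mul (by positivity),
          ENNReal.ofReal_pow (by positivity), ← NNReal.coe_real_pi, ENNReal.ofReal_coe_nnreal]
      have hfin := (ENNReal.ofReal_le_ofReal_iff (by positivity)).1 (hlow.trans hup)
      have h5 : B ^ 2 * r ^ 2 - (r ^ 2)⁻¹ - (B ^ 2 * ε ^ 2 - (ε ^ 2)⁻¹) ≤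
          (ε⁻¹ + K * ε ^ 2) ^ 2 / (1 - ε ^ 4 * B ^ 2) := by
        rw [← mul_sub] at hfin
        refine le_of_mul_le_mul_left (hfin.trans_eq ?_) Real.pi_pos
        field_simp
      rw [le_div_iff₀ hdpos] at h5
      have h6 : (ε⁻¹ + K * ε ^ 2) ^ 2 = (ε ^ 2)⁻¹ + 2 * K * ε + K ^ 2 * ε ^ 4 := by
        field_simp; ring
      have h7 : (ε ^ 2)⁻¹ * (1 - ε ^ 4 * B ^ 2) = (ε ^ 2)⁻¹ - ε ^ 2 * B ^ 2 := by
        field_simp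
      linarith
    have hlim : Tendsto (fun ε : ℝ => (1 - ε ^ 4 * B ^ 2) * (B ^ 2 * r ^ 2 - (r ^ 2)⁻¹) -
        (2 * K * ε + K ^ 2 * ε ^ 4 + B ^ 2 * ε ^ 2 + (1 - ε ^ 4 * B ^ 2) * B ^ 2 * ε ^ 2))
        (𝓝[>] 0) (𝓝 (B ^ 2 * r ^ 2 - (r ^ 2)⁻¹)) := by
      refine (Continuous.tendsto' (by fun_prop) _ _ ?_).mono_left nhdsWithin_le_nhds
      simp
    have := le_of_tendsto hlim hsmall
    linarith
  have hlim1 : Tendsto (fun r : ℝ => B ^ 2 * r ^ 2) (𝓝[<] 1) (𝓝 (B ^ 2)) :=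
    (Continuous.tendsto' (by fun_prop) _ _ (by simp)).mono_left nhdsWithin_le_nhds
  have hlim2 : Tendsto (fun r : ℝ => (r ^ 2)⁻¹) (𝓝[<] 1) (𝓝 1) := by
    have : ContinuousAt (fun r : ℝ => (r ^ 2)⁻¹) 1 := by
      refine ContinuousAt.inv₀ (by fun_prop) (by norm_num)
    simpa using this.tendsto.mono_left nhdsWithin_le_nhds
  have : B ^ 2 ≤ 1 := by
    refine le_of_tendsto_of_tendsto hlim1 hlim2 ?_
    filter_upwards [Ioo_mem_nhdsLT (zero_lt_one' ℝ)] with r hr using main r hr.1 hr.2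
  exact (sq_le_one_iff₀ (norm_nonneg b)).1 this

/-- The class `S` of normalized univalent functions on the unit disc. -/
structure IsSchlicht (f : ℂ → ℂ) : Prop where
  differentiableOn : DifferentiableOn ℂ f (ball 0 1)
  injOn : Set.InjOn f (ball 0 1)
  map_zero : f 0 = 0
  deriv_zero : deriv f 0 = 1

theorem exists_sq_eq_of_ne_zero {φ : ℂ → ℂ} (hφ : DifferentiableOn ℂ φ (ball 0 1))
    (h0 : ∀ z ∈ ball (0 : ℂ) 1, φ z ≠ 0) (h1 : φ 0 = 1) :
    ∃ ψ : ℂ → ℂ, DifferentiableOn ℂ ψ (ball 0 1) ∧ ψ 0 = 1 ∧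
      ∀ z ∈ ball (0 : ℂ) 1, ψ z ^ 2 = φ z := by
  have hφ' : DifferentiableOn ℂ (deriv φ) (ball 0 1) := hφ.deriv isOpen_ball
  obtain ⟨ℓ, hℓ0, hℓ⟩ := ((hφ'.fun_div hφ h0).isExactOn_ball).with_val_at 0 0
  have hℓd : DifferentiableOn ℂ ℓ (ball 0 1) := fun z hz =>
    (hℓ z hz).differentiableAt.differentiableWithinAt
  refine ⟨fun z => Complex.exp (ℓ z / 2), by fun_prop, by simp [hℓ0], fun z hz => ?_⟩
  have hconst : Complex.exp (-ℓ z) * φ z = Complex.exp (-ℓ 0) * φ 0 := by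
    refine isOpen_ball.is_const_of_deriv_eq_zero (convex_ball (0 : ℂ) 1).isPreconnected
      (f := fun z => Complex.exp (-ℓ z) * φ z) (by fun_prop) (fun w hw => ?_) hz
      (mem_ball_self one_pos)
    have hd : HasDerivAt φ (deriv φ w) w :=
      (hφ.differentiableAt (isOpen_ball.mem_nhds hw)).hasDerivAt
    have := ((hℓ w hw).neg.cexp).mul hd
    refine HasDerivAt.deriv (this.congr_deriv ?_)
    have := h0 w hw
    simp only [Pi.neg_apply, Pi.zero_apply]
    field_simp
    ring
  rw [hℓ0, h1, neg_zero, Complex.exp_zero, one_mul, Complex.exp_neg] at hconst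
  rw [← Complex.exp_nat_mul]
  have := Complex.exp_ne_zero (ℓ z)
  field_simp at hconst
  rw [hconst]
  congr 1
  push_cast
  ring

theorem mapsTo_sq_ball : Set.MapsTo (fun z : ℂ => z ^ 2) (ball 0 1) (ball 0 1) := fun z hz => by
  rw [mem_ball_zero_iff] at hz ⊢
  rw [norm_pow]
  exact pow_lt_one₀ (norm_nonneg z) hz two_ne_zero

theorem IsSchlicht.exists_sqrt_transform {f : ℂ → ℂ} (hf : IsSchlicht f) :
    ∃ ψ : ℂ → ℂ, DifferentiableOn ℂ ψ (ball 0 1) ∧ (∀ z ∈ ball (0 : ℂ) 1, ψ z ≠ 0) ∧ ψ 0 = 1 ∧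
      (∀ z ∈ ball (0 : ℂ) 1, f z = z * ψ z ^ 2) ∧
      Set.InjOn (fun z => z * ψ (z ^ 2)) (ball 0 1) := by
  have h0mem : (0 : ℂ) ∈ ball (0 : ℂ) 1 := mem_ball_self one_pos
  have hd : DifferentiableOn ℂ (dslope f 0) (ball 0 1) :=
    (Complex.differentiableOn_dslope (ball_mem_nhds 0 one_pos)).2 hf.differentiableOn
  have hmul : ∀ z, z * dslope f 0 z = f z := fun z => by
    simpa [hf.map_zero] using sub_smul_dslope f 0 z
  have hd0 : dslope f 0 0 = 1 := by rw [dslope_same, hf.deriv_zero]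
  have hne : ∀ z ∈ ball (0 : ℂ) 1, dslope f 0 z ≠ 0 := fun z hz h => by
    have h1 := hmul z
    rw [h, mul_zero, ← hf.map_zero] at h1
    have := hf.injOn h0mem hz h1
    rw [← this, hd0] at h
    exact one_ne_zero h
  obtain ⟨ψ, hψ, hψ0, hψsq⟩ := exists_sq_eq_of_ne_zero hd hne hd0
  have hψne : ∀ z ∈ ball (0 : ℂ) 1, ψ z ≠ 0 := fun z hz h => hne z hz (by rw [← hψsq z hz, h]; simp)
  have hfψ : ∀ z ∈ ball (0 : ℂ) 1, f z = z * ψ z ^ 2 := fun z hz => by rw [hψsq z hz, hmul]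
  refine ⟨ψ, hψ, hψne, hψ0, hfψ, fun z hz w hw h => ?_⟩
  simp only at h
  have hsq : z ^ 2 = w ^ 2 := by
    refine hf.injOn (mapsTo_sq_ball hz) (mapsTo_sq_ball hw) ?_
    rw [hfψ _ (mapsTo_sq_ball hz), hfψ _ (mapsTo_sq_ball hw), ← mul_pow, ← mul_pow, h]
  rw [hsq] at h
  exact mul_right_cancel₀ (hψne _ (mapsTo_sq_ball hw)) h

/-- **Bieberbach's theorem** on the second coefficient. -/
theorem IsSchlicht.norm_iteratedDeriv_two_le {f : ℂ → ℂ} (hf : IsSchlicht f) :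
    ‖iteratedDeriv 2 f 0‖ ≤ 4 := by
  obtain ⟨ψ, hψ, hψne, hψ0, hfψ, hinj⟩ := hf.exists_sqrt_transform
  have h0mem : (0 : ℂ) ∈ ball (0 : ℂ) 1 := mem_ball_self one_pos
  have hψat : HasDerivAt ψ (deriv ψ 0) 0 :=
    (hψ.differentiableAt (ball_mem_nhds 0 one_pos)).hasDerivAt
  obtain ⟨c, S, hS, hc⟩ := exists_eq_sum_add_pow_mul hψ 2
  obtain ⟨e, m, hm, he⟩ := exists_eq_sum_add_pow_mul (hψ.fun_inv hψne) 2
  have hc1 : deriv ψ 0 = c 1 := by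
    simpa using iteratedDeriv_zero_of_eq_sum_add_pow_mul one_lt_two hS fun z _ => hc z
  have he1 : -deriv ψ 0 = e 1 := by
    have h1 := iteratedDeriv_zero_of_eq_sum_add_pow_mul one_lt_two hm fun z _ => he z
    have h2 := (hψat.fun_inv (hψne 0 h0mem)).deriv
    rw [iteratedDeriv_one, h2, hψ0] at h1
    simpa using h1
  have hc0 : c 0 = 1 := by simpa [hψ0, Finset.sum_range_succ] using (hc 0).symm
  have he0 : e 0 = 1 := by simpa [hψ0, Finset.sum_range_succ] using (he 0).symm
  have hb : ‖e 1‖ ≤ 1 := by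
    refine norm_le_one_of_injOn_inv_add hm fun z hz w hw h => ?_
    have key : ∀ z ∈ ball (0 : ℂ) 1 \ {0},
        z⁻¹ + e 1 * z + z ^ 3 * m (z ^ 2) = (z * ψ (z ^ 2))⁻¹ := fun z hz => by
      have hz0 : z ≠ 0 := hz.2
      rw [mul_inv, he (z ^ 2), Finset.sum_range_succ, Finset.sum_range_one, he0]
      field_simp
    simp only [key z hz, key w hw] at h
    exact hinj hz.1 hw.1 (inv_injective h)
  have hf2 := iteratedDeriv_zero_of_eq_sum_add_pow_mul (F := f) (k := 2) (m := 3)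
    (R := fun z => 2 * S z + (c 1 + z * S z) ^ 2)
    (c := fun j => if j = 0 then 0 else if j = 1 then 1 else 2 * c 1) (by norm_num)
    (by fun_prop) fun z hz => by
      rw [hfψ z hz, hc z]
      simp [Finset.sum_range_succ, hc0]
      ring
  rw [← he1, norm_neg] at hb
  rw [hf2, ← hc1]
  simp only [OfNat.ofNat_ne_zero, OfNat.ofNat_ne_one, if_false, norm_mul]
  norm_num
  linarith

section KoebeTransform

variable {ζ : ℂ}

theorem one_add_conj_mul_ne_zero (hζ : ‖ζ‖ < 1) {z : ℂ} (hz : ‖z‖ < 1) :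
    1 + (starRingEnd ℂ) ζ * z ≠ 0 := fun h => by
  have h1 : ‖(starRingEnd ℂ) ζ * z‖ = 1 := by
    rw [← neg_eq_of_add_eq_zero_right h, norm_neg, norm_one]
  rw [norm_mul, RCLike.norm_conj] at h1
  nlinarith [norm_nonneg ζ, norm_nonneg z]

theorem mobius_mem_ball (hζ : ‖ζ‖ < 1) {z : ℂ} (hz : ‖z‖ < 1) :
    (z + ζ) / (1 + (starRingEnd ℂ) ζ * z) ∈ ball (0 : ℂ) 1 := by
  have h := one_add_conj_mul_ne_zero hζ hz
  rw [mem_ball_zero_iff, norm_div, div_lt_one (norm_pos_iff.2 h)]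
  refine lt_of_pow_lt_pow_left₀ 2 (norm_nonneg _) ?_
  have h1 : (0 : ℝ) < (1 - ‖z‖ ^ 2) * (1 - ‖ζ‖ ^ 2) :=
    mul_pos (by nlinarith [norm_nonneg z]) (by nlinarith [norm_nonneg ζ])
  have h2 : ‖1 + (starRingEnd ℂ) ζ * z‖ ^ 2 - ‖z + ζ‖ ^ 2 = (1 - ‖z‖ ^ 2) * (1 - ‖ζ‖ ^ 2) := by
    simp only [← Complex.normSq_eq_norm_sq, Complex.normSq_apply]
    simp
    ring
  linarith

theorem hasDerivAt_mobius (hζ : ‖ζ‖ < 1) {z : ℂ} (hz : ‖z‖ < 1) :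
    HasDerivAt (fun z => (z + ζ) / (1 + (starRingEnd ℂ) ζ * z))
      ((1 - ‖ζ‖ ^ 2) / (1 + (starRingEnd ℂ) ζ * z) ^ 2) z := by
  have h := one_add_conj_mul_ne_zero hζ hz
  refine (((hasDerivAt_id' z).add_const ζ).fun_div
    (((hasDerivAt_id' z).const_mul ((starRingEnd ℂ) ζ)).const_add 1) h).congr_deriv ?_
  rw [← Complex.mul_conj' ζ]
  congr 1
  ring

/-- The Koebe transform of a schlicht function has second coefficient bounded by `2`. -/
theorem IsSchlicht.norm_sub_le_of_deriv_ne_zero {f : ℂ → ℂ} (hf : IsSchlicht f) (hζ : ‖ζ‖ < 1)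
    (hfζ : deriv f ζ ≠ 0) :
    ‖(1 - ‖ζ‖ ^ 2) * deriv (deriv f) ζ - 2 * (starRingEnd ℂ) ζ * deriv f ζ‖ ≤
      4 * ‖deriv f ζ‖ := by
  set T : ℂ → ℂ := fun z => (z + ζ) / (1 + (starRingEnd ℂ) ζ * z) with hT
  have hρ : (1 - (‖ζ‖ : ℂ) ^ 2) ≠ 0 := by
    have : 1 - ‖ζ‖ ^ 2 ≠ 0 := by nlinarith [norm_nonneg ζ]
    exact_mod_cast this
  set D : ℂ := (1 - (‖ζ‖ : ℂ) ^ 2) * deriv f ζ with hD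
  have hD0 : D ≠ 0 := mul_ne_zero hρ hfζ
  set F : ℂ → ℂ := fun z => (f (T z) - f ζ) / D with hF
  have hT0 : T 0 = ζ := by simp [hT]
  have hTd : ∀ z ∈ ball (0 : ℂ) 1,
      HasDerivAt T ((1 - ‖ζ‖ ^ 2) / (1 + (starRingEnd ℂ) ζ * z) ^ 2) z := fun z hz =>
    hasDerivAt_mobius hζ (mem_ball_zero_iff.1 hz)
  have hTm : ∀ z ∈ ball (0 : ℂ) 1, T z ∈ ball (0 : ℂ) 1 := fun z hz =>
    mobius_mem_ball hζ (mem_ball_zero_iff.1 hz)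
  have hd : ∀ z ∈ ball (0 : ℂ) 1, HasDerivAt f (deriv f z) z := fun z hz =>
    (hf.differentiableOn.differentiableAt (isOpen_ball.mem_nhds hz)).hasDerivAt
  have hd' : ∀ z ∈ ball (0 : ℂ) 1, HasDerivAt (deriv f) (deriv (deriv f) z) z := fun z hz =>
    ((hf.differentiableOn.deriv isOpen_ball).differentiableAt
      (isOpen_ball.mem_nhds hz)).hasDerivAt
  have h0mem : (0 : ℂ) ∈ ball (0 : ℂ) 1 := mem_ball_self one_pos
  have hFd : ∀ z ∈ ball (0 : ℂ) 1, HasDerivAt F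
      (deriv f (T z) * ((1 - ‖ζ‖ ^ 2) / (1 + (starRingEnd ℂ) ζ * z) ^ 2) / D) z := fun z hz =>
    (((hd _ (hTm z hz)).comp z (hTd z hz)).sub_const (f ζ)).div_const D
  have hFS : IsSchlicht F := by
    refine ⟨fun z hz => (hFd z hz).differentiableAt.differentiableWithinAt,
      fun z hz w hw h => ?_, by simp [hF, hT0], ?_⟩
    · have h1 : T z = T w := hf.injOn (hTm z hz) (hTm w hw)
        (sub_left_injective ((div_left_inj' hD0).1 h))
      have h2 := one_add_conj_mul_ne_zero hζ (mem_ball_zero_iff.1 hz)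
      have h3 := one_add_conj_mul_ne_zero hζ (mem_ball_zero_iff.1 hw)
      simp only [hT] at h1
      rw [div_eq_div_iff h2 h3] at h1
      refine sub_eq_zero.1 ((mul_eq_zero.1 (?_ : (z - w) * (1 - (‖ζ‖ : ℂ) ^ 2) = 0)).resolve_right
        hρ)
      rw [← Complex.mul_conj' ζ]
      linear_combination h1
    · rw [(hFd 0 h0mem).deriv, hT0, hD]
      simp only [mul_zero, add_zero, one_pow, div_one]
      field_simp
  have hF2 : iteratedDeriv 2 F 0 = ((1 - (‖ζ‖ : ℂ) ^ 2) * deriv (deriv f) ζ -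
      2 * (starRingEnd ℂ) ζ * deriv f ζ) / deriv f ζ := by
    have hev : deriv F =ᶠ[𝓝 0] fun z =>
        deriv f (T z) * ((1 - ‖ζ‖ ^ 2) / (1 + (starRingEnd ℂ) ζ * z) ^ 2) / D := by
      filter_upwards [ball_mem_nhds (0 : ℂ) one_pos] with z hz using (hFd z hz).deriv
    rw [iteratedDeriv_succ, iteratedDeriv_one, hev.deriv_eq]
    have h4 : HasDerivAt (fun z : ℂ => (1 - (‖ζ‖ : ℂ) ^ 2) / (1 + (starRingEnd ℂ) ζ * z) ^ 2)
        (-(2 * (starRingEnd ℂ) ζ * (1 - (‖ζ‖ : ℂ) ^ 2))) 0 := by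
      refine ((hasDerivAt_const (0 : ℂ) (1 - (‖ζ‖ : ℂ) ^ 2)).fun_div
        ((((hasDerivAt_id' (0 : ℂ)).const_mul ((starRingEnd ℂ) ζ)).const_add 1).fun_pow 2)
        (by simp)).congr_deriv ?_
      simp
      ring
    have h5 := ((((hd' _ (hTm 0 h0mem)).comp 0 (hTd 0 h0mem)).mul h4).div_const D).deriv
    refine h5.trans ?_
    simp only [Function.comp_apply, hT0, mul_zero, add_zero, one_pow, div_one, hD]
    field_simp
    ring
  have := hFS.norm_iteratedDeriv_two_le
  rwa [hF2, norm_div, div_le_iff₀ (norm_pos_iff.2 hfζ)] at this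

theorem IsSchlicht.norm_sub_le {f : ℂ → ℂ} (hf : IsSchlicht f) (hζ : ‖ζ‖ < 1) :
    ‖(1 - ‖ζ‖ ^ 2) * deriv (deriv f) ζ - 2 * (starRingEnd ℂ) ζ * deriv f ζ‖ ≤
      4 * ‖deriv f ζ‖ := by
  by_cases hfζ : deriv f ζ ≠ 0
  · exact hf.norm_sub_le_of_deriv_ne_zero hζ hfζ
  have hmem : ball (0 : ℂ) 1 ∈ 𝓝 ζ := isOpen_ball.mem_nhds (mem_ball_zero_iff.2 hζ)
  have hd1 : DifferentiableOn ℂ (deriv f) (ball 0 1) := hf.differentiableOn.deriv isOpen_ball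
  have hd2 : DifferentiableOn ℂ (deriv (deriv f)) (ball 0 1) := hd1.deriv isOpen_ball
  have hne : ∀ᶠ z in 𝓝[≠] ζ, deriv f z ≠ 0 := by
    refine (hd1.analyticAt hmem).eventually_eq_zero_or_eventually_ne_zero.resolve_left fun h => ?_
    have := (hd1.analyticOnNhd isOpen_ball).eqOn_zero_of_preconnected_of_eventuallyEq_zero
      (convex_ball (0 : ℂ) 1).isPreconnected (mem_ball_zero_iff.2 hζ) h
    have h1 := this (mem_ball_self one_pos)
    rw [hf.deriv_zero] at h1
    exact one_ne_zero h1
  have hc1 : ContinuousAt (deriv f) ζ := (hd1.differentiableAt hmem).continuousAt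
  have hc2 : ContinuousAt (deriv (deriv f)) ζ := (hd2.differentiableAt hmem).continuousAt
  have hl : ContinuousAt (fun ζ : ℂ => ‖(1 - (‖ζ‖ : ℂ) ^ 2) * deriv (deriv f) ζ -
      2 * (starRingEnd ℂ) ζ * deriv f ζ‖) ζ := by
    have : ContinuousAt (starRingEnd ℂ) ζ := Complex.continuous_conj.continuousAt
    fun_prop
  have hr : ContinuousAt (fun ζ : ℂ => 4 * ‖deriv f ζ‖) ζ := by fun_prop
  refine le_of_tendsto_of_tendsto (b := 𝓝[≠] ζ) (hl.tendsto.mono_left nhdsWithin_le_nhds)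
    (hr.tendsto.mono_left nhdsWithin_le_nhds) ?_
  filter_upwards [hne, nhdsWithin_le_nhds hmem] with z hz hz1
  exact hf.norm_sub_le_of_deriv_ne_zero (mem_ball_zero_iff.1 hz1) hz

end KoebeTransform

theorem IsSchlicht.norm_deriv_le {f : ℂ → ℂ} (hf : IsSchlicht f) {η : ℂ} (hη : ‖η‖ = 1)
    {r : ℝ} (hr : 0 ≤ r) (hr1 : r < 1) :
    ‖deriv f (r * η)‖ ≤ (1 + r) / (1 - r) ^ 3 := by
  have hnorm : ∀ x : ℝ, 0 ≤ x → ‖(x : ℂ) * η‖ = x := fun x hx => by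
    rw [norm_mul, hη, mul_one, Complex.norm_real, Real.norm_eq_abs, abs_of_nonneg hx]
  have hk : ∀ x ∈ Set.Ico (0 : ℝ) 1, HasDerivAt (fun x : ℝ => deriv f (x * η))
      (deriv (deriv f) (x * η) * η) x := fun x hx => by
    have hmem : (x : ℂ) * η ∈ ball (0 : ℂ) 1 := by
      rw [mem_ball_zero_iff, hnorm x hx.1]; exact hx.2
    have h1 : HasDerivAt (deriv f) (deriv (deriv f) (x * η)) (x * η) :=
      ((hf.differentiableOn.deriv isOpen_ball).differentiableAt
        (isOpen_ball.mem_nhds hmem)).hasDerivAt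
    have h2 : HasDerivAt (fun w : ℂ => w * η) η (x : ℂ) := by
      simpa using (hasDerivAt_id' (x : ℂ)).mul_const η
    exact (h1.comp (x : ℂ) h2).comp_ofReal
  set V : ℝ → ℝ := fun x => ‖deriv f (x * η)‖ ^ 2 * ((1 - x) ^ 6 / (1 + x) ^ 2) with hV
  set V' : ℝ → ℝ := fun x => 2 * inner ℝ (deriv f (x * η)) (deriv (deriv f) (x * η) * η) *
    ((1 - x) ^ 6 / (1 + x) ^ 2) - ‖deriv f (x * η)‖ ^ 2 *
      ((8 + 4 * x) * ((1 - x) ^ 5 / (1 + x) ^ 3)) with hV'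
  have hVd : ∀ x ∈ Set.Ico (0 : ℝ) 1, HasDerivAt V (V' x) x := fun x hx => by
    have hx1 : (1 + x) ≠ 0 := by linarith [hx.1]
    have h3 : HasDerivAt (fun x : ℝ => (1 - x) ^ 6 / (1 + x) ^ 2)
        (-((8 + 4 * x) * ((1 - x) ^ 5 / (1 + x) ^ 3))) x := by
      refine ((((hasDerivAt_id' x).const_sub 1).fun_pow 6).fun_div
        (((hasDerivAt_id' x).const_add 1).fun_pow 2) (pow_ne_zero 2 hx1)).congr_deriv ?_
      field_simp
      push_cast
      ring
    refine ((hk x hx).norm_sq.mul h3).congr_deriv ?_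
    simp only [hV']
    ring
  have hV0 : ∀ x ∈ Set.Ico (0 : ℝ) 1, V' x ≤ 0 := fun x hx => by
    have hx1 : 0 < 1 + x := by linarith [hx.1]
    have hx2 : 0 < 1 - x := by linarith [hx.2]
    have h4 := hf.norm_sub_le (ζ := x * η) (by rw [hnorm x hx.1]; exact hx.2)
    rw [hnorm x hx.1] at h4
    set k := deriv f (x * η)
    set l := deriv (deriv f) (x * η)
    have hηη : (starRingEnd ℂ) η * η = 1 := by
      rw [Complex.conj_mul', hη]; simp
    have h5 : ((starRingEnd ℂ) k * η *
        ((1 - (x : ℂ) ^ 2) * l - 2 * (starRingEnd ℂ) (x * η) * k)).re ≤ ‖k‖ * (4 * ‖k‖) := by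
      refine (Complex.re_le_norm _).trans ?_
      rw [norm_mul, norm_mul, RCLike.norm_conj, hη, mul_one]
      gcongr
    have h6 : (starRingEnd ℂ) k * η *
        ((1 - (x : ℂ) ^ 2) * l - 2 * (starRingEnd ℂ) (x * η) * k) =
        ((1 - x ^ 2 : ℝ) : ℂ) * ((l * η) * (starRingEnd ℂ) k) - ((2 * x * ‖k‖ ^ 2 : ℝ) : ℂ) := by
      push_cast
      rw [← Complex.conj_mul' k, map_mul, Complex.conj_ofReal]
      linear_combination (-2 * (starRingEnd ℂ) k * x * k) * hηη
    rw [h6, Complex.sub_re, Complex.re_ofReal_mul, Complex.ofReal_re] at h5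
    have h7 : inner ℝ k (l * η) = ((l * η) * (starRingEnd ℂ) k).re := by
      rw [Complex.inner, mul_comm]
    simp only [hV']
    rw [h7]
    have h8 : 2 * ((l * η) * (starRingEnd ℂ) k).re * ((1 - x) ^ 6 / (1 + x) ^ 2) -
        ‖k‖ ^ 2 * ((8 + 4 * x) * ((1 - x) ^ 5 / (1 + x) ^ 3)) =
        (2 * ((1 - x ^ 2) * ((l * η) * (starRingEnd ℂ) k).re) - ‖k‖ ^ 2 * (8 + 4 * x)) *
          ((1 - x) ^ 5 / (1 + x) ^ 3) := by
      field_simp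
      ring
    rw [h8]
    refine mul_nonpos_of_nonpos_of_nonneg ?_ (by positivity)
    nlinarith
  have hanti : V r ≤ V 0 := by
    refine antitoneOn_of_deriv_nonpos (convex_Ico (0 : ℝ) 1)
      (fun x hx => (hVd x hx).continuousAt.continuousWithinAt)
      (fun x hx => (hVd x (interior_subset hx)).differentiableAt.differentiableWithinAt)
      (fun x hx => ?_) ⟨le_rfl, one_pos⟩ ⟨hr, hr1⟩ hr
    rw [(hVd x (interior_subset hx)).deriv]
    exact hV0 x (interior_subset hx)
  have hr2 : 0 < 1 - r := by linarith
  have hV00 : V 0 = 1 := by simp [hV, hf.deriv_zero]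
  rw [hV00] at hanti
  refine le_of_sq_le_sq ?_ (by positivity)
  simp only [hV] at hanti
  rw [div_pow, le_div_iff₀ (by positivity)]
  rw [← mul_div_assoc, div_le_one (by positivity)] at hanti
  linarith

/-- The **growth theorem** for schlicht functions. -/
theorem IsSchlicht.norm_le {f : ℂ → ℂ} (hf : IsSchlicht f) {z : ℂ} (hz : ‖z‖ < 1) :
    ‖f z‖ ≤ ‖z‖ / (1 - ‖z‖) ^ 2 := by
  rcases eq_or_ne z 0 with rfl | hz0
  · simp [hf.map_zero]
  set r := ‖z‖ with hr
  have hr0 : 0 < r := norm_pos_iff.2 hz0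
  set η : ℂ := z / r with hηdef
  have hη : ‖η‖ = 1 := by
    rw [hηdef, norm_div, Complex.norm_real, norm_norm, ← hr, div_self hr0.ne']
  have hzη : (r : ℂ) * η = z := by
    have hrc : (r : ℂ) ≠ 0 := by exact_mod_cast hr0.ne'
    rw [hηdef]
    field_simp
  have hd : ∀ x ∈ Set.Icc (0 : ℝ) r, HasDerivAt (fun x : ℝ => f (x * η))
      (deriv f (x * η) * η) x := fun x hx => by
    have hmem : (x : ℂ) * η ∈ ball (0 : ℂ) 1 := by
      rw [mem_ball_zero_iff, norm_mul, hη, mul_one, Complex.norm_real, Real.norm_eq_abs,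
        abs_of_nonneg hx.1]
      exact hx.2.trans_lt hz
    have h1 : HasDerivAt f (deriv f (x * η)) (x * η) :=
      (hf.differentiableOn.differentiableAt (isOpen_ball.mem_nhds hmem)).hasDerivAt
    have h2 : HasDerivAt (fun w : ℂ => w * η) η (x : ℂ) := by
      simpa using (hasDerivAt_id' (x : ℂ)).mul_const η
    exact (h1.comp (x : ℂ) h2).comp_ofReal
  have hB : ∀ x ∈ Set.Icc (0 : ℝ) r,
      HasDerivAt (fun x : ℝ => x / (1 - x) ^ 2) ((1 + x) / (1 - x) ^ 3) x := fun x hx => by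
    have hx1 : 1 - x ≠ 0 := by linarith [hx.2]
    refine ((hasDerivAt_id' x).fun_div (((hasDerivAt_id' x).const_sub 1).fun_pow 2)
      (pow_ne_zero 2 hx1)).congr_deriv ?_
    field_simp
    push_cast
    ring
  have := image_norm_le_of_norm_deriv_right_le_deriv_boundary'
    (fun x hx => (hd x hx).continuousAt.continuousWithinAt)
    (fun x hx => (hd x (Set.Ico_subset_Icc_self hx)).hasDerivWithinAt) (by simp [hf.map_zero])
    (fun x hx => (hB x hx).continuousAt.continuousWithinAt)
    (fun x hx => (hB x (Set.Ico_subset_Icc_self hx)).hasDerivWithinAt)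
    (fun x hx => by
      rw [norm_mul, hη, mul_one]
      exact hf.norm_deriv_le hη hx.1 (hx.2.trans hz)) (Set.right_mem_Icc.2 hr0.le)
  rwa [hzη] at this

theorem mul_deriv_eq_sum_add_pow_mul {F R : ℂ → ℂ} {c : ℕ → ℂ} {N : ℕ}
    (hR : DifferentiableOn ℂ R (ball 0 1))
    (h : ∀ z, F z = ∑ j ∈ Finset.range N, c j * z ^ j + z ^ N * R z) {z : ℂ}
    (hz : z ∈ ball (0 : ℂ) 1) :
    z * deriv F z = ∑ j ∈ Finset.range N, j * c j * z ^ j + z ^ N * (N * R z + z * deriv R z) := by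
  have hRd : HasDerivAt R (deriv R z) z :=
    (hR.differentiableAt (isOpen_ball.mem_nhds hz)).hasDerivAt
  have hF : HasDerivAt F (∑ j ∈ Finset.range N, c j * (j * z ^ (j - 1)) +
      (N * z ^ (N - 1) * R z + z ^ N * deriv R z)) z := by
    rw [funext h]
    exact (HasDerivAt.fun_sum fun j _ => (hasDerivAt_pow j z).const_mul (c j)).fun_add
      ((hasDerivAt_pow N z).mul hRd)
  have hp : ∀ k : ℕ, (k : ℂ) * z ^ k = z * (k * z ^ (k - 1)) := fun k => by
    cases k with
    | zero => simp
    | succ k => rw [Nat.add_sub_cancel]; ring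
  rw [hF.deriv, mul_add, Finset.mul_sum]
  congr 1
  · refine Finset.sum_congr rfl fun j _ => ?_
    linear_combination (-c j) * hp j
  · linear_combination (-R z) * hp N

theorem sum_mul_norm_sq_le {ψ R : ℂ → ℂ} {c : ℕ → ℂ} {n : ℕ}
    (hψ : DifferentiableOn ℂ ψ (ball 0 1)) (hR : DifferentiableOn ℂ R (ball 0 1))
    (hc : ∀ z, ψ z = ∑ j ∈ Finset.range n, c j * z ^ j + z ^ n * R z)
    (hinj : Set.InjOn (fun z => z * ψ (z ^ 2)) (ball 0 1))
    (hb : ∀ z ∈ ball (0 : ℂ) 1, ‖z * ψ (z ^ 2)‖ ≤ ‖z‖ / (1 - ‖z‖ ^ 2))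
    {s : ℝ} (hs : 0 < s) (hs1 : s < 1) :
    ∑ j ∈ Finset.range n, (2 * j + 1) * ‖c j‖ ^ 2 * s ^ (4 * j + 2) ≤ s ^ 2 / (1 - s ^ 2) ^ 2 := by
  have hAb : {z : ℂ | 0 < ‖z‖ ∧ ‖z‖ < s} ⊆ ball 0 1 := fun z hz => by
    rw [mem_ball_zero_iff]
    exact hz.2.trans hs1
  have hψ' : DifferentiableOn ℂ (deriv ψ) (ball 0 1) := hψ.deriv isOpen_ball
  have hR' : DifferentiableOn ℂ (deriv R) (ball 0 1) := hR.deriv isOpen_ball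
  have hsq : DifferentiableOn ℂ (fun z : ℂ => z ^ 2) (ball 0 1) := by fun_prop
  set g' : ℂ → ℂ := fun z => ψ (z ^ 2) + 2 * (z ^ 2 * deriv ψ (z ^ 2)) with hg'
  have hg'd : DifferentiableOn ℂ g' (ball 0 1) :=
    (hψ.comp hsq mapsTo_sq_ball).add
      ((hsq.mul (hψ'.comp hsq mapsTo_sq_ball)).const_mul 2)
  have hg : ∀ z ∈ ball (0 : ℂ) 1, HasDerivAt (fun z => z * ψ (z ^ 2)) (g' z) z := fun z hz => by
    have h1 : HasDerivAt ψ (deriv ψ (z ^ 2)) (z ^ 2) :=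
      (hψ.differentiableAt (isOpen_ball.mem_nhds (mapsTo_sq_ball hz))).hasDerivAt
    have h2 : HasDerivAt (fun z => ψ (z ^ 2)) (deriv ψ (z ^ 2) * (2 * z)) z :=
      (h1.comp z (hasDerivAt_pow 2 z)).congr_deriv (by simp)
    refine ((hasDerivAt_id' z).mul h2).congr_deriv ?_
    simp only [hg']
    ring
  have hexp : ∀ z ∈ ball (0 : ℂ) 1, g' z = ∑ j ∈ Finset.range n, (2 * j + 1) * c j * z ^ (2 * j) +
      z ^ (2 * n) * (R (z ^ 2) + 2 * (n * R (z ^ 2) + z ^ 2 * deriv R (z ^ 2))) := fun z hz => by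
    have h1 := mul_deriv_eq_sum_add_pow_mul hR hc (mapsTo_sq_ball hz)
    simp only at h1
    simp only [hg']
    rw [h1, hc (z ^ 2)]
    simp only [pow_mul, mul_add, Finset.mul_sum]
    have : ∀ j ∈ Finset.range n, (2 * (j : ℂ) + 1) * c j * (z ^ 2) ^ j =
        c j * (z ^ 2) ^ j + 2 * (j * c j * (z ^ 2) ^ j) := fun j _ => by ring
    rw [Finset.sum_congr rfl this, Finset.sum_add_distrib]
    ring
  have hRd : DifferentiableOn ℂ
      (fun z => R (z ^ 2) + 2 * (n * R (z ^ 2) + z ^ 2 * deriv R (z ^ 2))) (ball 0 1) :=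
    (hR.comp hsq mapsTo_sq_ball).add ((((hR.comp hsq mapsTo_sq_ball).const_mul (n : ℂ)).add
      (hsq.mul (hR'.comp hsq mapsTo_sq_ball))).const_mul 2)
  have hA : MeasurableSet {z : ℂ | 0 < ‖z‖ ∧ ‖z‖ < s} := by measurability
  have hvol := volume_image_eq_lintegral hA (fun z hz => hg z (hAb hz)) (hinj.mono hAb)
  have hlow := ofReal_sub_le_lintegral_annulus (ε := 0) (s := s) le_rfl hs.le
    (Φ := fun z => ‖g' z‖ ^ 2)
    (G := fun t => Real.pi * ∑ j ∈ Finset.range n, (2 * j + 1) * ‖c j‖ ^ 2 * t ^ (4 * j + 2))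
    (L := fun t => ∑ j ∈ Finset.range n, ‖(2 * j + 1) * c j‖ ^ 2 * t ^ (2 * 2 * j))
    ((hg'd.continuousOn.mono hAb).norm.pow 2) (fun z => by positivity) (fun t _ => ?_)
    (by fun_prop) (fun t ht => Finset.sum_nonneg fun j _ => by have := ht.1; positivity)
    (fun t ht => sum_le_circleAverage_norm_sq two_ne_zero ht.1 (ht.2.trans hs1) hRd hexp)
  · rw [← hvol] at hlow
    have hsub : (fun z => z * ψ (z ^ 2)) '' {z : ℂ | 0 < ‖z‖ ∧ ‖z‖ < s} ⊆
        closedBall 0 (s / (1 - s ^ 2)) := by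
      rintro _ ⟨z, hz, rfl⟩
      rw [mem_closedBall_zero_iff]
      have hz2 : ‖z‖ < s := hz.2
      refine (hb z (hAb hz)).trans ?_
      have : 0 < 1 - s ^ 2 := by nlinarith
      gcongr
    have hup := hlow.trans (measure_mono hsub)
    have hs2 : 0 < 1 - s ^ 2 := by nlinarith
    rw [Complex.volume_closedBall, ← ENNReal.ofReal_pow (by positivity), ← NNReal.coe_real_pi] at hup
    rw [← ENNReal.ofReal_coe_nnreal, ← ENNReal.ofReal_mul (by positivity),
      ENNReal.ofReal_le_ofReal_iff (by positivity), NNReal.coe_real_pi] at hup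
    have h0 : ∑ j ∈ Finset.range n, (2 * (j : ℝ) + 1) * ‖c j‖ ^ 2 * 0 ^ (4 * j + 2) = 0 :=
      Finset.sum_eq_zero fun j _ => by simp
    rw [h0, mul_zero, sub_zero, div_pow, mul_comm] at hup
    exact le_of_mul_le_mul_right hup Real.pi_pos
  · refine (HasDerivAt.const_mul _ (HasDerivAt.fun_sum fun j _ =>
      (hasDerivAt_pow (4 * j + 2) t).const_mul ((2 * (j : ℝ) + 1) * ‖c j‖ ^ 2))).congr_deriv ?_
    simp only [Finset.mul_sum]
    refine Finset.sum_congr rfl fun j _ => ?_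
    have h1 : ‖(2 * (j : ℂ) + 1)‖ = 2 * j + 1 := by
      have : (2 * (j : ℂ) + 1) = ((2 * j + 1 : ℕ) : ℂ) := by push_cast; rfl
      rw [this, Complex.norm_natCast]
      push_cast
      rfl
    rw [norm_mul, h1, show 4 * j + 2 - 1 = 2 * 2 * j + 1 by omega]
    push_cast
    ring

/-- Integrated form of the area estimate. -/
theorem sum_norm_sq_mul_pow_le {n : ℕ} {b : ℕ → ℝ}
    (h : ∀ s : ℝ, 0 < s → s < 1 →
      ∑ j ∈ Finset.range n, (2 * j + 1) * b j * s ^ (4 * j + 2) ≤ s ^ 2 / (1 - s ^ 2) ^ 2)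
    {y : ℝ} (hy : 0 ≤ y) (hy1 : y < 1) :
    ∑ j ∈ Finset.range n, b j * y ^ (2 * j + 1) ≤ y / (1 - y) := by
  set Q : ℝ → ℝ := fun y => ∑ j ∈ Finset.range n, b j * y ^ (2 * j + 1) - y / (1 - y) with hQ
  have hd : ∀ x ∈ Set.Ico (0 : ℝ) 1, HasDerivAt Q
      (∑ j ∈ Finset.range n, b j * ((2 * j + 1) * x ^ (2 * j)) - 1 / (1 - x) ^ 2) x :=
    fun x hx => by
      have hx1 : 1 - x ≠ 0 := by linarith [hx.2]
      refine (HasDerivAt.fun_sum fun j _ =>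
        ((hasDerivAt_pow (2 * j + 1) x).const_mul (b j)).congr_deriv ?_).sub
        (((hasDerivAt_id' x).fun_div ((hasDerivAt_id' x).const_sub 1) hx1).congr_deriv ?_)
      · push_cast
        rfl
      · congr 1
        ring
  have hanti : Q y ≤ Q 0 := by
    refine antitoneOn_of_deriv_nonpos (convex_Ico (0 : ℝ) 1)
      (fun x hx => (hd x hx).continuousAt.continuousWithinAt)
      (fun x hx => (hd x (interior_subset hx)).differentiableAt.differentiableWithinAt)
      (fun x hx => ?_) ⟨le_rfl, one_pos⟩ ⟨hy, hy1⟩ hy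
    rw [(hd x (interior_subset hx)).deriv]
    rw [interior_Ico] at hx
    have h1 := h (√x) (Real.sqrt_pos.2 hx.1) (by rw [Real.sqrt_lt' one_pos]; simpa using hx.2)
    rw [Real.sq_sqrt hx.1.le] at h1
    have h2 : ∀ j ∈ Finset.range n, (2 * (j : ℝ) + 1) * b j * √x ^ (4 * j + 2) =
        x * (b j * ((2 * j + 1) * x ^ (2 * j))) := fun j _ => by
      rw [show 4 * j + 2 = 2 * (2 * j + 1) by ring, pow_mul, Real.sq_sqrt hx.1.le]
      ring
    rw [Finset.sum_congr rfl h2, ← Finset.mul_sum, div_eq_mul_one_div x] at h1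
    linarith [le_of_mul_le_mul_left h1 hx.1]
  have hQ0 : Q 0 = 0 := by simp [hQ]
  rw [hQ0] at hanti
  simp only [hQ] at hanti
  linarith

open Polynomial in
theorem exists_mul_sq_eq_sum {P : ℂ[X]} {R : ℂ → ℂ} (hR : DifferentiableOn ℂ R (ball 0 1)) (n : ℕ) :
    ∃ S : ℂ → ℂ, DifferentiableOn ℂ S (ball 0 1) ∧ ∀ z, z * (P.eval z + z ^ n * R z) ^ 2 =
      ∑ j ∈ Finset.range (n + 1), (X * (P * P)).coeff j * z ^ j + z ^ (n + 1) * S z := by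
  refine ⟨fun z => (divX^[n + 1] (X * (P * P))).eval z + 2 * P.eval z * R z + z ^ n * R z ^ 2,
    ?_, fun z => ?_⟩
  · have := fun p : ℂ[X] => p.differentiable.differentiableOn (s := ball (0 : ℂ) 1)
    have h1 := this P
    have h2 := this (divX^[n + 1] (X * (P * P)))
    fun_prop
  · have key : ∀ (p : ℂ[X]) (m : ℕ), p.eval z = ∑ j ∈ Finset.range m, p.coeff j * z ^ j +
        z ^ m * (divX^[m] p).eval z := fun p m => by
      induction m with
      | zero => simp
      | succ m ih =>
        have hco : (divX^[m] p).coeff 0 = p.coeff m := by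
          have : ∀ (k m : ℕ) (p : ℂ[X]), (divX^[m] p).coeff k = p.coeff (k + m) := fun k m => by
            induction m with
            | zero => simp
            | succ m ih =>
              intro p
              rw [Function.iterate_succ_apply, ih, coeff_divX, add_assoc]
          rw [this, zero_add]
        have h1 := congrArg (eval z) (divX_mul_X_add (divX^[m] p))
        rw [eval_add, eval_mul, eval_X, eval_C, hco] at h1
        rw [ih, Finset.sum_range_succ, Function.iterate_succ_apply', ← h1]
        ring
    have h1 := key (X * (P * P)) (n + 1)
    rw [eval_mul, eval_mul, eval_X] at h1
    linear_combination h1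

open Polynomial in
theorem coeff_X_mul_sum_mul_sum (c : ℕ → ℂ) {n : ℕ} (hn : n ≠ 0) :
    ((X : ℂ[X]) * ((∑ j ∈ Finset.range n, C (c j) * X ^ j) *
      ∑ j ∈ Finset.range n, C (c j) * X ^ j)).coeff n =
      ∑ j ∈ Finset.range n, c j * c (n - 1 - j) := by
  obtain ⟨m, rfl⟩ := Nat.exists_eq_succ_of_ne_zero hn
  rw [Nat.succ_eq_add_one, coeff_X_mul, coeff_mul, Finset.Nat.sum_antidiagonal_eq_sum_range_succ_mk]
  refine Finset.sum_congr rfl fun j hj => ?_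
  have hj' := Finset.mem_range.1 hj
  simp only [finsetSum_coeff, coeff_C_mul, coeff_X_pow, mul_ite, mul_one, mul_zero,
    Finset.sum_ite_eq, Finset.mem_range, Nat.add_sub_cancel]
  rw [if_pos (by omega), if_pos (by omega)]

/-- Sharpened bound: for every `y` in the unit interval `‖aₙ‖ yⁿ ≤ y / (1 - y)`. -/
theorem IsSchlicht.norm_coeff_mul_pow_le {f : ℂ → ℂ} (hf : IsSchlicht f) {n : ℕ} (hn : n ≠ 0)
    {y : ℝ} (hy : 0 ≤ y) (hy1 : y < 1) :
    ‖iteratedDeriv n f 0 / n.factorial‖ * y ^ n ≤ y / (1 - y) := by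
  obtain ⟨ψ, hψ, -, -, hfψ, hinj⟩ := hf.exists_sqrt_transform
  obtain ⟨c, R, hR, hc⟩ := exists_eq_sum_add_pow_mul hψ n
  have hb : ∀ z ∈ ball (0 : ℂ) 1, ‖z * ψ (z ^ 2)‖ ≤ ‖z‖ / (1 - ‖z‖ ^ 2) := fun z hz => by
    have hz2 := mapsTo_sq_ball hz
    have h1 := hf.norm_le (mem_ball_zero_iff.1 hz2)
    simp only at h1
    rw [hfψ _ hz2, ← mul_pow, norm_pow, norm_pow, ← div_pow] at h1
    have hz1 := mem_ball_zero_iff.1 hz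
    have : 0 < 1 - ‖z‖ ^ 2 := by nlinarith [norm_nonneg z]
    exact le_of_sq_le_sq h1 (by positivity)
  have hsum := sum_norm_sq_mul_pow_le
    (fun s hs hs1 => sum_mul_norm_sq_le hψ hR hc hinj hb hs hs1) hy hy1
  refine le_trans ?_ hsum
  obtain ⟨S, hS, hfS⟩ := exists_mul_sq_eq_sum
    (P := ∑ j ∈ Finset.range n, Polynomial.C (c j) * Polynomial.X ^ j) hR n
  have hcoeff := iteratedDeriv_zero_of_eq_sum_add_pow_mul (F := f) n.lt_succ_self hS fun z hz => by
    rw [hfψ z hz, hc z, ← hfS z]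
    simp [Polynomial.eval_finsetSum]
  rw [hcoeff, coeff_X_mul_sum_mul_sum c hn,
    mul_div_cancel_left₀ _ (by exact_mod_cast n.factorial_ne_zero)]
  have hrefl : ∑ j ∈ Finset.range n, ‖c (n - 1 - j)‖ ^ 2 * y ^ (2 * (n - 1 - j) + 1) =
      ∑ j ∈ Finset.range n, ‖c j‖ ^ 2 * y ^ (2 * j + 1) :=
    Finset.sum_range_reflect (fun j => ‖c j‖ ^ 2 * y ^ (2 * j + 1)) n
  have hterm : ∀ j ∈ Finset.range n, ‖c j * c (n - 1 - j)‖ * y ^ n ≤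
      (‖c j‖ ^ 2 * y ^ (2 * j + 1) + ‖c (n - 1 - j)‖ ^ 2 * y ^ (2 * (n - 1 - j) + 1)) / 2 :=
    fun j hj => by
      have hj' := Finset.mem_range.1 hj
      have hpow : y ^ n = y * (y ^ j * y ^ (n - 1 - j)) := by
        rw [← pow_add, ← pow_succ']
        congr 1
        omega
      rw [norm_mul, hpow]
      have h1 := mul_nonneg hy (sq_nonneg (‖c j‖ * y ^ j - ‖c (n - 1 - j)‖ * y ^ (n - 1 - j)))
      rw [pow_succ y, pow_succ y, mul_comm 2 j, mul_comm 2 (n - 1 - j), pow_mul, pow_mul]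
      linarith
  calc _ ≤ (∑ j ∈ Finset.range n, ‖c j * c (n - 1 - j)‖) * y ^ n := by
        gcongr
        exact norm_sum_le _ _
    _ ≤ ∑ j ∈ Finset.range n, (‖c j‖ ^ 2 * y ^ (2 * j + 1) +
        ‖c (n - 1 - j)‖ ^ 2 * y ^ (2 * (n - 1 - j) + 1)) / 2 := by
        rw [Finset.sum_mul]
        exact Finset.sum_le_sum hterm
    _ = _ := by
        rw [← Finset.sum_div, Finset.sum_add_distrib, hrefl]
        ring

/-- **Littlewood's theorem.** For `f` in the class `S` with Taylor coefficients `a`,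
`|a n| ≤ e · n` for all `n ≥ 2`. -/
theorem littlewood_theorem (f : ℂ → ℂ)
    (hf : DifferentiableOn ℂ f (ball (0 : ℂ) 1))
    (hinj : Set.InjOn f (ball (0 : ℂ) 1))
    (hf0 : f 0 = 0) (hf1 : deriv f 0 = 1)
    (a : ℕ → ℂ) (ha : ∀ n, a n = iteratedDeriv n f 0 / (n.factorial : ℂ)) :
    ∀ n : ℕ, 2 ≤ n → ‖a n‖ ≤ Real.exp 1 * n := by
  intro n hn
  obtain ⟨m, rfl⟩ : ∃ m, n = m + 1 := ⟨n - 1, by omega⟩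
  have hm : (0 : ℝ) < m := by exact_mod_cast (by omega : 0 < m)
  have h := IsSchlicht.norm_coeff_mul_pow_le ⟨hf, hinj, hf0, hf1⟩ m.succ_ne_zero
    (y := m / (m + 1)) (by positivity) (by rw [div_lt_one (by positivity)]; linarith)
  rw [Nat.succ_eq_add_one, ← ha, show (m / (m + 1) : ℝ) / (1 - m / (m + 1)) = m by field_simp; simp,
    pow_succ] at h
  have he := Real.one_add_inv_pow_le_exp (n := m)
  have hinv : (1 + (m : ℝ)⁻¹) * (m / (m + 1)) = 1 := by field_simp
  have hp : 0 ≤ (1 + (m : ℝ)⁻¹) ^ m := by positivity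
  have key : ‖a (m + 1)‖ ≤ (1 + (m : ℝ)⁻¹) ^ m * (m + 1) := by
    have h2 := mul_le_mul_of_nonneg_left h hp
    have h3 : (1 + (m : ℝ)⁻¹) ^ m * (‖a (m + 1)‖ * ((m / (m + 1)) ^ m * (m / (m + 1)))) =
        ‖a (m + 1)‖ * (m / (m + 1)) := by
      linear_combination (‖a (m + 1)‖ * (m / (m + 1))) *
        ((mul_pow (1 + (m : ℝ)⁻¹) (m / (m + 1)) m).symm.trans (by rw [hinv, one_pow]))
    rw [h3, ← mul_div_assoc, div_le_iff₀ (by positivity)] at h2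
    nlinarith
  push_cast
  exact key.trans (by gcongr)
end
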